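/- arXiv:2309.07342 — 3 statements merged into one kernel-verified Lean document; each statement's English description precedes it below -/
import Mathlib

section
/- There exists a constant C > 0, depending only on q' and F, such that the following holds. For every m ≥ 1, every λ ≥ 0, and every pair (a, c) solving the mode-λ model system on (0,∞) with asymptotic data (c₀, O, O·log m) at τ = 0, one has for all τ ∈ (0, 1/(2m)]: (i) (1+λ²)·(a(τ)/log(mτ))² + ((d/dτ)(a(τ)/log(mτ)))² ≤ C·((1+λ²)·O² + m⁻²·c₀²); (ii) (a(τ)/log(mτ))² ≤ C·(O² + τ²·λ²·O² + τ²·m⁻²·c₀²); (iii) c(τ)² ≤ C·(c₀² + τ²·(1+λ²)·O²). (This is the single spherical-harmonic-mode version of the paper's low-frequency estimate for the singular component α_Y, Proposition 3.2.) -/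
open Set Filter

/-- The pair `(a, c)` solves the mode-`lam` model system on `I ⊆ (0,∞)`:
`a` is twice differentiable and `c` is differentiable on `I`, and for all `τ ∈ I`,
(E) `a'' + τ⁻¹·a' + 4q'·a + 4λ²·(τ²+1)⁻²·a = f₁·τ·a' + f₂·τ²·a + f₃·c` and
(C) `c' = 2τ·a`. -/
def SolvesModelSystem (q' : ℝ) (f₁ f₂ f₃ : ℝ → ℝ) (lam : ℝ)
    (a c : ℝ → ℝ) (I : Set ℝ) : Prop :=
  ∀ τ ∈ I,
    DifferentiableAt ℝ a τ ∧ DifferentiableAt ℝ (deriv a) τ ∧ DifferentiableAt ℝ c τ ∧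
    (deriv (deriv a) τ + τ⁻¹ * deriv a τ + 4 * q' * a τ
        + 4 * lam ^ 2 * ((τ ^ 2 + 1) ^ 2)⁻¹ * a τ
      = f₁ τ * τ * deriv a τ + f₂ τ * τ ^ 2 * a τ + f₃ τ * c τ) ∧
    deriv c τ = 2 * τ * a τ

/-- The pair `(a, c)` (solving the model system on `(0,∞)`, with `c` extended
continuously to `[0,∞)`) has asymptotic data `(c₀, O, h)` at `τ = 0`. -/
def HasAsymptoticData (a c : ℝ → ℝ) (c₀ O h : ℝ) : Prop :=
  ContinuousOn c (Ici 0) ∧ c 0 = c₀ ∧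
  ∃ K : ℝ, 0 ≤ K ∧ ∀ τ ∈ Ioc (0:ℝ) 1,
    |a τ - O * Real.log τ - h| ≤ K * τ ^ 2 * (1 + Real.log τ ^ 2) ∧
    |deriv a τ - O / τ| ≤ K * τ * (1 + Real.log τ ^ 2)

/-- A function with nonpositive derivative on `(0, T]` lies below its limit at `0⁺`. -/
theorem le_of_hasDerivAt_nonpos_of_tendsto {g g' : ℝ → ℝ} {T l : ℝ}
    (hd : ∀ s ∈ Ioc 0 T, HasDerivAt g (g' s) s) (hg' : ∀ s ∈ Ioc 0 T, g' s ≤ 0)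
    (hl : Tendsto g (nhdsWithin 0 (Ioi 0)) (nhds l)) : ∀ s ∈ Ioc 0 T, g s ≤ l := by
  have anti : AntitoneOn g (Ioc 0 T) := by
    refine antitoneOn_of_deriv_nonpos (convex_Ioc 0 T)
      (fun s hs => (hd s hs).continuousAt.continuousWithinAt)
      (fun s hs => (hd s (interior_subset hs)).differentiableAt.differentiableWithinAt)
      (fun s hs => ?_)
    rw [(hd s (interior_subset hs)).deriv]
    exact hg' s (interior_subset hs)
  intro s hs
  refine ge_of_tendsto hl ?_
  filter_upwards [Ioc_mem_nhdsGT hs.1] with t ht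
  exact anti ⟨ht.1, ht.2.trans hs.2⟩ hs ht.2

/-- One-sided mean value inequality anchored at a limit at `0⁺`. -/
theorem abs_sub_le_of_abs_deriv_le_of_tendsto {g g' : ℝ → ℝ} {T l M : ℝ}
    (hd : ∀ s ∈ Ioc 0 T, HasDerivAt g (g' s) s) (hg' : ∀ s ∈ Ioc 0 T, |g' s| ≤ M)
    (hl : Tendsto g (nhdsWithin 0 (Ioi 0)) (nhds l)) :
    ∀ s ∈ Ioc 0 T, |g s - l| ≤ M * s := by
  have hM : Tendsto (fun s : ℝ => M * s) (nhdsWithin 0 (Ioi 0)) (nhds 0) := by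
    have : Tendsto (fun s : ℝ => M * s) (nhds 0) (nhds (M * 0)) :=
      (continuous_const.mul continuous_id).tendsto 0
    rw [mul_zero] at this
    exact this.mono_left nhdsWithin_le_nhds
  have hMd : ∀ s : ℝ, HasDerivAt (fun s : ℝ => M * s) M s := fun s => by
    simpa using (hasDerivAt_id s).const_mul M
  have up := le_of_hasDerivAt_nonpos_of_tendsto (T := T)
    (fun s hs => (hd s hs).sub (hMd s))
    (fun s hs => by linarith [(abs_le.mp (hg' s hs)).2]) (hl.sub hM)
  have dn := le_of_hasDerivAt_nonpos_of_tendsto (T := T)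
    (fun s hs => (hd s hs).neg.sub (hMd s))
    (fun s hs => by linarith [(abs_le.mp (hg' s hs)).1]) (hl.neg.sub hM)
  intro s hs
  have h1 := up s hs
  have h2 := dn s hs
  simp only [Pi.sub_apply, Pi.neg_apply] at h1 h2
  rw [abs_le]
  constructor <;> linarith

theorem log_le_neg_two_thirds {x : ℝ} (hx : 0 < x) (hx' : x ≤ 1 / 2) :
    Real.log x ≤ -(2 / 3) := by
  have h := Real.log_le_log hx hx'
  rw [one_div, Real.log_inv] at h
  linarith [Real.log_two_gt_d9]

theorem neg_one_add_two_div_log_le {x : ℝ} (hx : 0 < x) (hx' : x ≤ 1 / 2) :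
    -(1 + 2 / Real.log x) ≤ 27 * x := by
  have hL := log_le_neg_two_thirds hx hx'
  have hL0 : Real.log x ≠ 0 := by linarith
  rw [neg_le, ← sub_nonneg]
  have : 1 + 2 / Real.log x - -(27 * x)
      = (-Real.log x * (1 + 27 * x) - 2) / (-Real.log x) := by
    field_simp
    ring
  rw [this]
  refine div_nonneg ?_ (by linarith)
  by_cases h : Real.log x ≤ -2
  · nlinarith
  · have hx9 : 1 / 9 ≤ x := by
      have h2 : Real.exp (-2) ≤ x := by
        rw [← Real.le_log_iff_exp_le hx]
        linarith
      have h3 : Real.exp 2 ≤ 9 := by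
        have : Real.exp 2 = Real.exp 1 * Real.exp 1 := by
          rw [← Real.exp_add]
          norm_num
        rw [this]
        nlinarith [Real.exp_one_lt_d9, Real.exp_pos 1]
      have h4 : 1 / 9 ≤ Real.exp (-2) := by
        rw [Real.exp_neg, one_div]
        exact inv_anti₀ (Real.exp_pos 2) h3
      linarith
    nlinarith

theorem abs_mul_log_le_one {x : ℝ} (hx : 0 < x) (hx' : x ≤ 1) : |x * Real.log x| ≤ 1 := by
  rw [mul_comm]
  exact (Real.abs_log_mul_self_lt x hx hx').le

/-- Pointwise energy inequality: `A = P`, `B = b`, `e = c / m`, `R = 1 / log (m τ)`. -/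
theorem energy_deriv_le {F m s P b e V dV R w f₁ f₂ f₃ : ℝ} (hm : 1 ≤ m)
    (hs : 0 < s) (hs' : s ≤ 1 / 2) (hV : 1 ≤ V) (hdV : dV ≤ 0)
    (hR : |R| ≤ 3 / 2) (hRs : -(1 + 2 * R) / s ≤ 27 * m) (hw : |w| ≤ 1)
    (h₁ : |f₁| ≤ F) (h₂ : |f₂| ≤ F) (h₃ : |f₃| ≤ F) :
    2 * P * (-(1 + 2 * R) / s * P - V * b + f₁ * s * P + f₁ * R * b + f₂ * s ^ 2 * b
        + f₃ * R * (m * e)) + (dV * b ^ 2 + V * (2 * b * P)) + 4 * e * w * b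
      ≤ (60 + 10 * F) * m * (P ^ 2 + V * b ^ 2 + e ^ 2) := by
  have hF : 0 ≤ F := (abs_nonneg _).trans h₁
  have key : ∀ k B x y : ℝ, |k| ≤ B → 2 * (k * (x * y)) ≤ B * (x ^ 2 + y ^ 2) := by
    intro k B x y h
    have h5 := abs_le.mp h
    nlinarith [mul_nonneg (by linarith : 0 ≤ B - k) (sq_nonneg (x - y)),
      mul_nonneg (by linarith : 0 ≤ B + k) (sq_nonneg (x + y))]
  have hfR : ∀ f : ℝ, |f| ≤ F → |f * R| ≤ F * (3 / 2) := fun f hf => by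
    rw [abs_mul]
    exact mul_le_mul hf hR (abs_nonneg _) hF
  have t1 : -(1 + 2 * R) / s * P ^ 2 ≤ 27 * m * P ^ 2 :=
    mul_le_mul_of_nonneg_right hRs (sq_nonneg P)
  have t2 : f₁ * s * P ^ 2 ≤ F * P ^ 2 := by
    refine mul_le_mul_of_nonneg_right ?_ (sq_nonneg P)
    nlinarith [(abs_le.mp h₁).2]
  have t3 := key (f₁ * R) _ P b (hfR _ h₁)
  have t4 := key (f₂ * s ^ 2) F P b (by
    rw [abs_mul, abs_of_nonneg (sq_nonneg s)]
    exact (mul_le_of_le_one_right (abs_nonneg _) (by nlinarith)).trans h₂)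
  have t5 := mul_le_mul_of_nonneg_left (key (f₃ * R) _ P e (hfR _ h₃)) (by linarith : 0 ≤ m)
  have t6 := key w 1 e b hw
  have t7 : dV * b ^ 2 ≤ 0 := mul_nonpos_of_nonpos_of_nonneg hdV (sq_nonneg b)
  have hVb : b ^ 2 ≤ V * b ^ 2 := by nlinarith [sq_nonneg b]
  set W := V * b ^ 2
  have hmG : P ^ 2 + W + e ^ 2 ≤ m * (P ^ 2 + W + e ^ 2) := by
    nlinarith [sq_nonneg b, sq_nonneg P, sq_nonneg e]
  have hFm := mul_le_mul_of_nonneg_left hmG hF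
  have n1 : 0 ≤ m * P ^ 2 := by positivity
  have n2 : 0 ≤ m * e ^ 2 := by positivity
  have n3 : 0 ≤ m * W := mul_nonneg (by linarith) (by linarith [sq_nonneg b])
  have n4 := mul_nonneg hF n1
  have n5 := mul_nonneg hF n2
  have n6 := mul_nonneg hF n3
  have n7 := mul_le_mul_of_nonneg_left hVb hF
  have n8 := mul_nonneg hF (sq_nonneg P)
  have e1 : 2 * P * (-(1 + 2 * R) / s * P - V * b + f₁ * s * P + f₁ * R * b + f₂ * s ^ 2 * b
        + f₃ * R * (m * e)) + (dV * b ^ 2 + V * (2 * b * P)) + 4 * e * w * b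
      = 2 * (-(1 + 2 * R) / s * P ^ 2) + 2 * (f₁ * s * P ^ 2) + 2 * (f₁ * R * (P * b))
        + 2 * (f₂ * s ^ 2 * (P * b)) + m * (2 * (f₃ * R * (P * e))) + dV * b ^ 2
        + 2 * (2 * (w * (e * b))) := by ring
  rw [e1]
  nlinarith [sq_nonneg P, sq_nonneg e]

/-- `s * (1 + log² s)` vanishes as `s → 0⁺`. -/
theorem tendsto_mul_one_add_log_sq :
    Tendsto (fun s : ℝ => s * (1 + Real.log s ^ 2)) (nhdsWithin 0 (Ioi 0)) (nhds 0) := by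
  have h0 : Tendsto (fun s : ℝ => s) (nhdsWithin 0 (Ioi 0)) (nhds 0) :=
    tendsto_id.mono_left nhdsWithin_le_nhds
  have h := tendsto_log_mul_rpow_nhdsGT_zero (r := 1 / 2) (by norm_num)
  have h2 := h0.add (h.mul h)
  simp only [mul_zero, add_zero] at h2
  refine h2.congr' ?_
  filter_upwards [self_mem_nhdsWithin] with s hs
  have hs : 0 < s := hs
  have : s ^ (1 / 2 : ℝ) * s ^ (1 / 2 : ℝ) = s := by
    rw [← Real.rpow_add hs]
    norm_num
  calc s + Real.log s * s ^ (1 / 2 : ℝ) * (Real.log s * s ^ (1 / 2 : ℝ))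
      = s + Real.log s ^ 2 * (s ^ (1 / 2 : ℝ) * s ^ (1 / 2 : ℝ)) := by ring
    _ = _ := by rw [this]; ring

/-- The derivative of `s ↦ a s / log (m s)`, in closed form. -/
noncomputable def quotDeriv (m : ℝ) (a : ℝ → ℝ) (s : ℝ) : ℝ :=
  (deriv a s - a s / Real.log (m * s) / s) / Real.log (m * s)

theorem hasDerivAt_log_mul {m s : ℝ} (hm : 0 < m) (hs : 0 < s) :
    HasDerivAt (fun t => Real.log (m * t)) s⁻¹ s := by
  have h := ((hasDerivAt_id s).const_mul m).log (by simpa using ⟨hm.ne', hs.ne'⟩)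
  have e : m * 1 / (m * id s) = s⁻¹ := by
    simp only [id]
    field_simp
  rw [e] at h
  exact h

theorem hasDerivAt_quot {m s : ℝ} {a : ℝ → ℝ} (hm : 0 < m) (hs : 0 < s)
    (hL : Real.log (m * s) ≠ 0) (ha : DifferentiableAt ℝ a s) :
    HasDerivAt (fun t => a t / Real.log (m * t)) (quotDeriv m a s) s := by
  have h := ha.hasDerivAt.div (hasDerivAt_log_mul hm hs) hL
  refine h.congr_deriv ?_
  unfold quotDeriv
  field_simp

theorem hasDerivAt_quotDeriv {m s : ℝ} {a : ℝ → ℝ} (hm : 0 < m) (hs : 0 < s)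
    (hL : Real.log (m * s) ≠ 0) (ha : DifferentiableAt ℝ a s)
    (ha' : DifferentiableAt ℝ (deriv a) s) :
    HasDerivAt (quotDeriv m a)
      ((deriv (deriv a) s - 2 * (quotDeriv m a s / s) + a s / Real.log (m * s) / s ^ 2)
        / Real.log (m * s)) s := by
  have h := (ha'.hasDerivAt.sub ((hasDerivAt_quot hm hs hL ha).div (hasDerivAt_id s) hs.ne')).div
    (hasDerivAt_log_mul hm hs) hL
  refine h.congr_deriv ?_
  simp only [Pi.sub_apply, Pi.div_apply, id]
  unfold quotDeriv
  field_simp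
  ring

/-- Limits at `0⁺` of the quotient `a / log (m ·)` and of its derivative. -/
theorem tendsto_quot_and_quotDeriv {m O K : ℝ} {a : ℝ → ℝ} (hm : 1 ≤ m) (hK : 0 ≤ K)
    (h : ∀ τ ∈ Ioc (0 : ℝ) 1,
      |a τ - O * Real.log τ - O * Real.log m| ≤ K * τ ^ 2 * (1 + Real.log τ ^ 2) ∧
      |deriv a τ - O / τ| ≤ K * τ * (1 + Real.log τ ^ 2)) :
    Tendsto (fun s => a s / Real.log (m * s)) (nhdsWithin 0 (Ioi 0)) (nhds O) ∧
    Tendsto (quotDeriv m a) (nhdsWithin 0 (Ioi 0)) (nhds 0) := by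
  have hm0 : 0 < m := by linarith
  have hlim : ∀ k : ℝ,
      Tendsto (fun s : ℝ => k * (s * (1 + Real.log s ^ 2))) (nhdsWithin 0 (Ioi 0)) (nhds 0) :=
    fun k => by simpa using tendsto_mul_one_add_log_sq.const_mul k
  have hT : (0 : ℝ) < 1 / (2 * m) := by positivity
  have bounds : ∀ s ∈ Ioc (0 : ℝ) (1 / (2 * m)),
      |a s / Real.log (m * s) - O| ≤ 3 / 2 * K * (s * (1 + Real.log s ^ 2)) ∧
      |quotDeriv m a s| ≤ 6 * K * (s * (1 + Real.log s ^ 2)) := by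
    intro s hs
    have hs0 := hs.1
    have hms : m * s ≤ 1 / 2 := by
      have := (le_div_iff₀ (by positivity)).mp hs.2
      linarith
    have hs1 : s ≤ 1 := by nlinarith
    have hL := log_le_neg_two_thirds (mul_pos hm0 hs0) hms
    have hLe : Real.log (m * s) = Real.log m + Real.log s := Real.log_mul hm0.ne' hs0.ne'
    obtain ⟨h1, h2⟩ := h s ⟨hs0, hs1⟩
    set L := Real.log (m * s)
    have hL0 : L ≠ 0 := by linarith
    have hLabs : 2 / 3 ≤ |L| := by rw [abs_of_nonpos (by linarith)]; linarith
    have divL : ∀ x B : ℝ, |x| ≤ B → |x / L| ≤ 3 / 2 * B := by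
      intro x B hx
      rw [abs_div, div_le_iff₀ (by linarith)]
      nlinarith [abs_nonneg x]
    set Y := 1 + Real.log s ^ 2
    have hY : 0 ≤ Y := by positivity
    have e1 : a s / L - O = (a s - O * Real.log s - O * Real.log m) / L := by
      field_simp
      rw [hLe]
      ring
    have b1 : |a s / L - O| ≤ 3 / 2 * (K * s ^ 2 * Y) := by
      rw [e1]
      exact divL _ _ h1
    have hKY : 0 ≤ K * s * Y := by positivity
    refine ⟨b1.trans (by nlinarith), ?_⟩
    have e2 : quotDeriv m a s = ((deriv a s - O / s) - (a s / L - O) / s) / L := by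
      change (deriv a s - a s / L / s) / L = _
      ring
    have b2 : |(a s / L - O) / s| ≤ 3 / 2 * (K * s * Y) := by
      rw [abs_div, abs_of_pos hs0, div_le_iff₀ hs0]
      linarith
    rw [e2]
    refine (divL _ _ ((abs_sub _ _).trans (add_le_add h2 b2))).trans ?_
    nlinarith
  constructor
  · rw [tendsto_iff_norm_sub_tendsto_zero]
    refine squeeze_zero' (Eventually.of_forall fun _ => norm_nonneg _) ?_ (hlim (3 / 2 * K))
    filter_upwards [Ioc_mem_nhdsGT hT] with s hs
    exact (bounds s hs).1
  · rw [tendsto_zero_iff_norm_tendsto_zero]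
    refine squeeze_zero' (Eventually.of_forall fun _ => norm_nonneg _) ?_ (hlim (6 * K))
    filter_upwards [Ioc_mem_nhdsGT hT] with s hs
    exact (bounds s hs).2

/-- The potential of the mode-`lam` wave equation. -/
noncomputable def potential (q' lam s : ℝ) : ℝ := 4 * q' + 4 * lam ^ 2 * ((s ^ 2 + 1) ^ 2)⁻¹

theorem hasDerivAt_potential (q' lam s : ℝ) :
    HasDerivAt (potential q' lam) (-(16 * lam ^ 2 * s * ((s ^ 2 + 1) ^ 3)⁻¹)) s := by
  have h0 : (s ^ 2 + 1) ≠ 0 := by positivity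
  have h := ((((((hasDerivAt_id s).pow 2).add_const 1).pow 2).inv (pow_ne_zero 2 h0)).const_mul
    (4 * lam ^ 2)).const_add (4 * q')
  refine h.congr_deriv ?_
  simp only [id, Pi.pow_apply]
  field_simp
  ring

theorem one_add_sq_le_potential {q' lam s : ℝ} (hq : 1 ≤ q') (hs : 0 ≤ s) (hs' : s ≤ 1 / 2) :
    1 + lam ^ 2 ≤ potential q' lam s := by
  have h1 : (s ^ 2 + 1) ^ 2 ≤ 4 := by
    have : s ^ 2 ≤ 1 := by nlinarith
    nlinarith [sq_nonneg s]
  have h2 : (4 : ℝ)⁻¹ ≤ ((s ^ 2 + 1) ^ 2)⁻¹ := inv_anti₀ (by positivity) h1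
  unfold potential
  nlinarith [sq_nonneg lam]

/-- Grönwall bound for the energy of the quotient `a / log (m ·)`. -/
theorem energy_le {q' F m lam c₀ O : ℝ} {f₁ f₂ f₃ a c : ℝ → ℝ} (hq : 1 ≤ q') (hF : 0 ≤ F)
    (h₁ : ∀ τ ≥ (0 : ℝ), |f₁ τ| ≤ F) (h₂ : ∀ τ ≥ (0 : ℝ), |f₂ τ| ≤ F)
    (h₃ : ∀ τ ≥ (0 : ℝ), |f₃ τ| ≤ F) (hm : 1 ≤ m)
    (hsol : SolvesModelSystem q' f₁ f₂ f₃ lam a c (Ioi 0))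
    (hb : Tendsto (fun s => a s / Real.log (m * s)) (nhdsWithin 0 (Ioi 0)) (nhds O))
    (hP : Tendsto (quotDeriv m a) (nhdsWithin 0 (Ioi 0)) (nhds 0))
    (hc : Tendsto c (nhdsWithin 0 (Ioi 0)) (nhds c₀)) :
    ∀ s ∈ Ioc (0 : ℝ) (1 / (2 * m)),
      quotDeriv m a s ^ 2 + potential q' lam s * (a s / Real.log (m * s)) ^ 2 + (c s / m) ^ 2
        ≤ 4 * q' * Real.exp (30 + 5 * F) * ((1 + lam ^ 2) * O ^ 2 + c₀ ^ 2 / m ^ 2) := by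
  have hm0 : 0 < m := by linarith
  set k := (60 + 10 * F) * m with hk
  set b := fun s => a s / Real.log (m * s) with hbdef
  set P := quotDeriv m a with hPdef
  set V := potential q' lam with hV
  have expd : ∀ s : ℝ, HasDerivAt (fun t => Real.exp (-(k * t))) (Real.exp (-(k * s)) * -k) s :=
    fun s => by simpa using (((hasDerivAt_id s).const_mul k).neg).exp
  have hsmall : ∀ s ∈ Ioc (0 : ℝ) (1 / (2 * m)), m * s ≤ 1 / 2 ∧ s ≤ 1 / 2 := by
    intro s hs
    have := (le_div_iff₀ (by positivity)).mp hs.2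
    constructor
    · linarith
    · nlinarith [hs.1]
  have hlim : Tendsto (fun s => Real.exp (-(k * s)) * (P s ^ 2 + V s * b s ^ 2 + (c s / m) ^ 2))
      (nhdsWithin 0 (Ioi 0))
      (nhds (Real.exp (-(k * 0)) * (0 ^ 2 + V 0 * O ^ 2 + (c₀ / m) ^ 2))) :=
    ((expd 0).continuousAt.tendsto.mono_left nhdsWithin_le_nhds).mul
      (((hP.pow 2).add (((hasDerivAt_potential q' lam 0).continuousAt.tendsto.mono_left
        nhdsWithin_le_nhds).mul (hb.pow 2))).add ((hc.div_const m).pow 2))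
  have hder : ∀ s ∈ Ioc (0 : ℝ) (1 / (2 * m)), ∃ d ≤ 0,
      HasDerivAt (fun s => Real.exp (-(k * s)) * (P s ^ 2 + V s * b s ^ 2 + (c s / m) ^ 2))
        d s := by
    intro s hs
    have hs0 := hs.1
    obtain ⟨hms, hs1⟩ := hsmall s hs
    have hL := log_le_neg_two_thirds (mul_pos hm0 hs0) hms
    have hL0 : Real.log (m * s) ≠ 0 := by linarith
    obtain ⟨ha, ha', hcd, hE, hC⟩ := hsol s hs0
    have dP := hasDerivAt_quotDeriv hm0 hs0 hL0 ha ha'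
    have db := hasDerivAt_quot hm0 hs0 hL0 ha
    have dV := hasDerivAt_potential q' lam s
    have dc := hcd.hasDerivAt
    have hG := (expd s).mul (((dP.pow 2).add (dV.mul (db.pow 2))).add ((dc.div_const m).pow 2))
    refine ⟨_, ?_, hG⟩
    set L := Real.log (m * s) with hLdef
    have hR : |L⁻¹| ≤ 3 / 2 := by
      rw [abs_inv, abs_of_nonpos (by linarith), inv_le_comm₀ (by linarith) (by norm_num)]
      linarith
    have hRs : -(1 + 2 * L⁻¹) / s ≤ 27 * m := by
      rw [div_le_iff₀ hs0]
      have := neg_one_add_two_div_log_le (mul_pos hm0 hs0) hms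
      rw [div_eq_mul_inv] at this
      linarith
    have hw : |s * L / m| ≤ 1 := by
      have h := abs_mul_log_le_one (mul_pos hm0 hs0) (by linarith)
      have e : m * s * L = (s * L / m) * m ^ 2 := by field_simp
      rw [← hLdef, e, abs_mul, abs_of_nonneg (sq_nonneg m)] at h
      exact (le_mul_of_one_le_right (abs_nonneg _) (by nlinarith)).trans h
    have hVs : 1 ≤ V s := by
      have := one_add_sq_le_potential (lam := lam) hq hs0.le hs1
      nlinarith [sq_nonneg lam]
    have hdV : -(16 * lam ^ 2 * s * ((s ^ 2 + 1) ^ 3)⁻¹) ≤ 0 := by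
      rw [neg_nonpos]
      positivity
    have key := energy_deriv_le (P := P s) (b := b s) (e := c s / m) hm hs0 hs1 hVs hdV hR hRs hw
      (h₁ s hs0.le) (h₂ s hs0.le) (h₃ s hs0.le)
    have haL : a s = b s * L := (div_mul_cancel₀ _ hL0).symm
    have ha'L : deriv a s = P s * L + b s / s := by
      change deriv a s = (deriv a s - b s / s) / L * L + b s / s
      rw [div_mul_cancel₀ _ hL0]
      ring
    have hQ : (deriv (deriv a) s - 2 * (P s / s) + b s / s ^ 2) / L
        = -(1 + 2 * L⁻¹) / s * P s - V s * b s + f₁ s * s * P s + f₁ s * L⁻¹ * b s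
          + f₂ s * s ^ 2 * b s + f₃ s * L⁻¹ * (m * (c s / m)) := by
      have hE' : deriv (deriv a) s = f₁ s * s * (P s * L + b s / s) + f₂ s * s ^ 2 * (b s * L)
          + f₃ s * c s - s⁻¹ * (P s * L + b s / s) - V s * (b s * L) := by
        rw [← haL, ← ha'L]
        simp only [hV, potential]
        linarith
      rw [hE']
      field_simp
      ring
    have hcm : 2 * (c s / m) * (deriv c s / m) = 4 * (c s / m) * (s * L / m) * b s := by
      rw [hC, haL]
      field_simp
      ring
    have hrate : 2 * P s * ((deriv (deriv a) s - 2 * (P s / s) + b s / s ^ 2) / L)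
        + (-(16 * lam ^ 2 * s * ((s ^ 2 + 1) ^ 3)⁻¹) * b s ^ 2 + V s * (2 * b s * P s))
        + 2 * (c s / m) * (deriv c s / m) ≤ k * (P s ^ 2 + V s * b s ^ 2 + (c s / m) ^ 2) := by
      rw [hQ, hcm]
      exact key
    have hexp := Real.exp_pos (-(k * s))
    simp only [Pi.pow_apply, Pi.add_apply, Pi.mul_apply, Nat.cast_ofNat]
    simp only [Nat.add_one_sub_one, pow_one]
    have := mul_nonneg hexp.le (sub_nonneg.mpr hrate)
    simp only [hbdef, hPdef, hV] at this ⊢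
    linarith
  choose! d hd0 hd using hder
  intro s hs
  have hmono := le_of_hasDerivAt_nonpos_of_tendsto hd hd0 hlim s hs
  obtain ⟨hms, -⟩ := hsmall s hs
  simp only [mul_zero, neg_zero, Real.exp_zero, one_mul] at hmono
  rw [Real.exp_neg, inv_mul_le_iff₀ (Real.exp_pos _)] at hmono
  refine hmono.trans ?_
  have hke : Real.exp (k * s) ≤ Real.exp (30 + 5 * F) := by
    rw [Real.exp_le_exp, hk]
    nlinarith
  have hV0 : V 0 ≤ 4 * q' * (1 + lam ^ 2) := by
    simp only [hV, potential]
    norm_num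
    nlinarith [sq_nonneg lam]
  have hV00 : 0 ≤ V 0 := by
    simp only [hV, potential]
    positivity
  have hdata : 0 ^ 2 + V 0 * O ^ 2 + (c₀ / m) ^ 2
      ≤ 4 * q' * ((1 + lam ^ 2) * O ^ 2 + c₀ ^ 2 / m ^ 2) := by
    rw [div_pow]
    have h5 := mul_le_mul_of_nonneg_right hV0 (sq_nonneg O)
    have h6 : 0 ≤ c₀ ^ 2 / m ^ 2 := by positivity
    nlinarith
  calc Real.exp (k * s) * (0 ^ 2 + V 0 * O ^ 2 + (c₀ / m) ^ 2)
      ≤ Real.exp (30 + 5 * F) * (4 * q' * ((1 + lam ^ 2) * O ^ 2 + c₀ ^ 2 / m ^ 2)) :=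
        mul_le_mul hke hdata (by positivity) (Real.exp_pos _).le
    _ = _ := by ring

theorem sq_le_of_abs_sub_le {x y N A Y X : ℝ} (h : |x - y| ≤ N) (hN : N ^ 2 ≤ 4 * (A * Y))
    (hA : 0 ≤ A) (hy : y ^ 2 ≤ X) (hY : Y ≤ X) : x ^ 2 ≤ (2 + 8 * A) * X := by
  have h1 := sq_le_sq' (abs_le.mp h).1 (abs_le.mp h).2
  have h2 := mul_le_mul_of_nonneg_left hY hA
  have h3 := sq_nonneg (x - 2 * y)
  linarith

/-- Low-frequency estimate for the singular component (single-mode version of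
Proposition 3.2 of the paper). -/
theorem lowFrequency_singular_estimate (q' F : ℝ) (hq : 1 ≤ q') (hF : 0 ≤ F) :
    ∃ C > 0, ∀ f₁ f₂ f₃ : ℝ → ℝ,
      ContinuousOn f₁ (Ici 0) → ContinuousOn f₂ (Ici 0) → ContinuousOn f₃ (Ici 0) →
      (∀ τ ≥ (0:ℝ), |f₁ τ| ≤ F) → (∀ τ ≥ (0:ℝ), |f₂ τ| ≤ F) → (∀ τ ≥ (0:ℝ), |f₃ τ| ≤ F) →
      ∀ m lam : ℝ, 1 ≤ m → 0 ≤ lam →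
      ∀ a c : ℝ → ℝ, ∀ c₀ O : ℝ,
      SolvesModelSystem q' f₁ f₂ f₃ lam a c (Ioi 0) →
      HasAsymptoticData a c c₀ O (O * Real.log m) →
      ∀ τ ∈ Ioc (0:ℝ) (1 / (2 * m)),
        ((1 + lam ^ 2) * (a τ / Real.log (m * τ)) ^ 2
              + (deriv (fun s => a s / Real.log (m * s)) τ) ^ 2
            ≤ C * ((1 + lam ^ 2) * O ^ 2 + c₀ ^ 2 / m ^ 2)) ∧
        ((a τ / Real.log (m * τ)) ^ 2
            ≤ C * (O ^ 2 + τ ^ 2 * lam ^ 2 * O ^ 2 + τ ^ 2 * c₀ ^ 2 / m ^ 2)) ∧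
        (c τ ^ 2 ≤ C * (c₀ ^ 2 + τ ^ 2 * (1 + lam ^ 2) * O ^ 2)) := by
  set A := 4 * q' * Real.exp (30 + 5 * F) with hA
  have hA0 : 0 < A := by positivity
  refine ⟨2 + 8 * A, by positivity, ?_⟩
  rintro f₁ f₂ f₃ - - - h₁ h₂ h₃ m lam hm - a c c₀ O hsol ⟨hcont, hc0, K, hK, hasym⟩
  have hm0 : 0 < m := by linarith
  obtain ⟨hb, hP⟩ := tendsto_quot_and_quotDeriv hm hK hasym
  have hc : Tendsto c (nhdsWithin 0 (Ioi 0)) (nhds c₀) := by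
    rw [← hc0]
    exact (hcont 0 self_mem_Ici).mono_left (nhdsWithin_mono _ Ioi_subset_Ici_self)
  have hen := energy_le hq hF h₁ h₂ h₃ hm hsol hb hP hc
  rw [← hA] at hen
  set D := (1 + lam ^ 2) * O ^ 2 + c₀ ^ 2 / m ^ 2 with hD
  have hD0 : 0 ≤ D := by positivity
  have hfacts : ∀ s ∈ Ioc (0 : ℝ) (1 / (2 * m)), m * s ≤ 1 / 2 ∧ s ≤ 1 / 2 ∧
      (1 + lam ^ 2) * (a s / Real.log (m * s)) ^ 2 + quotDeriv m a s ^ 2 ≤ A * D ∧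
      HasDerivAt (fun t => a t / Real.log (m * t)) (quotDeriv m a s) s := by
    intro s hs
    have hs0 := hs.1
    have hms : m * s ≤ 1 / 2 := by
      have := (le_div_iff₀ (by positivity)).mp hs.2
      linarith
    have hs1 : s ≤ 1 / 2 := by nlinarith
    have hL := log_le_neg_two_thirds (mul_pos hm0 hs0) hms
    refine ⟨hms, hs1, ?_, hasDerivAt_quot hm0 hs0 (by linarith) (hsol s hs0).1⟩
    have h5 := mul_le_mul_of_nonneg_right
      (one_add_sq_le_potential (lam := lam) hq hs0.le hs1) (sq_nonneg (a s / Real.log (m * s)))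
    linarith [hen s hs, sq_nonneg (c s / m)]
  have hAD : 0 ≤ A * D := by positivity
  have hM2 : Real.sqrt (A * D) ^ 2 = A * D := Real.sq_sqrt hAD
  set M := Real.sqrt (A * D)
  have hbO := abs_sub_le_of_abs_deriv_le_of_tendsto (M := M)
    (fun s hs => (hfacts s hs).2.2.2)
    (fun s hs => Real.abs_le_sqrt (by
      obtain ⟨-, -, h, -⟩ := hfacts s hs
      nlinarith [mul_nonneg (by positivity : 0 ≤ 1 + lam ^ 2)
        (sq_nonneg (a s / Real.log (m * s)))])) hb
  have hcc := abs_sub_le_of_abs_deriv_le_of_tendsto (T := 1 / (2 * m)) (M := 2 * M)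
    (fun s hs => (hsol s hs.1).2.2.1.hasDerivAt)
    (fun s hs => by
      obtain ⟨hms, hs1, h, -⟩ := hfacts s hs
      have hs0 := hs.1
      have hL := log_le_neg_two_thirds (mul_pos hm0 hs0) hms
      have hbM : |a s / Real.log (m * s)| ≤ M := Real.abs_le_sqrt (by
        nlinarith [mul_nonneg (sq_nonneg lam) (sq_nonneg (a s / Real.log (m * s))),
          sq_nonneg (quotDeriv m a s)])
      have hsL : |s * Real.log (m * s)| ≤ 1 := by
        have h := abs_mul_log_le_one (mul_pos hm0 hs0) (by linarith)
        rw [mul_assoc, abs_mul, abs_of_pos hm0] at h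
        nlinarith [abs_nonneg (s * Real.log (m * s))]
      have e : deriv c s = 2 * ((s * Real.log (m * s)) * (a s / Real.log (m * s))) := by
        have hL0 : Real.log (m * s) ≠ 0 := by linarith
        rw [(hsol s hs0).2.2.2.2, mul_assoc s, mul_div_cancel₀ _ hL0]
        ring
      rw [e, abs_mul, abs_two, abs_mul]
      nlinarith [abs_nonneg (a s / Real.log (m * s))]) hc
  intro τ hτ
  have hτ0 := hτ.1
  obtain ⟨-, hτ1, hi, hd⟩ := hfacts τ hτ
  have hτ2 : τ ^ 2 ≤ 1 := by nlinarith
  have hcm : 0 ≤ c₀ ^ 2 / m ^ 2 := by positivity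
  have hcm' : c₀ ^ 2 / m ^ 2 ≤ c₀ ^ 2 := div_le_self (sq_nonneg _) (by nlinarith)
  have hlO : 0 ≤ τ ^ 2 * lam ^ 2 * O ^ 2 := by positivity
  have hτO : τ ^ 2 * O ^ 2 ≤ O ^ 2 := by nlinarith [sq_nonneg O]
  have hτc : 0 ≤ τ ^ 2 * c₀ ^ 2 / m ^ 2 := by positivity
  have hτD : τ ^ 2 * D = τ ^ 2 * O ^ 2 + τ ^ 2 * lam ^ 2 * O ^ 2 + τ ^ 2 * c₀ ^ 2 / m ^ 2 := by
    rw [hD]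
    ring
  refine ⟨?_, ?_, ?_⟩
  · rw [hd.deriv]
    exact hi.trans (mul_le_mul_of_nonneg_right (by linarith) hD0)
  · refine sq_le_of_abs_sub_le (hbO τ hτ) (Y := τ ^ 2 * D) ?_ hA0.le (by linarith) (by linarith)
    have : 0 ≤ A * D * τ ^ 2 := by positivity
    rw [mul_pow, hM2]
    linarith
  · have h9 : 0 ≤ τ ^ 2 * (1 + lam ^ 2) * O ^ 2 := by positivity
    refine sq_le_of_abs_sub_le (hcc τ hτ) (Y := τ ^ 2 * D) ?_ hA0.le (by linarith) ?_
    · rw [mul_pow, mul_pow, hM2]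
      linarith
    · have : τ ^ 2 * (c₀ ^ 2 / m ^ 2) ≤ c₀ ^ 2 := (mul_le_of_le_one_left hcm hτ2).trans hcm'
      rw [hD]
      linarith
end

section
/- There exists a constant C > 0, depending only on q' and F, such that the following holds. For every m ≥ 1, every λ ≥ 0, and every pair (a, c) solving the mode-λ model system on the interval [1/(2m), 1], one has for all τ ∈ [1/(2m), 1]: τ⁻¹·a(τ)² + τ·λ²·a(τ)² + τ·a'(τ)² ≤ (C/m)·( m²·a(1/(2m))² + λ²·a(1/(2m))² + a'(1/(2m))² + m·c(1/(2m))² ). (This is the single spherical-harmonic-mode version of the paper's high-frequency forward estimate, Proposition 3.3.) -/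
open Set Filter

/-- The modified energy at time `t` of a solution with values `x = a t`, `p = a' t`, `z = c t`. -/
noncomputable def modelEnergy (q' lam t x p z : ℝ) : ℝ :=
  t * p ^ 2 + x * p + t⁻¹ * x ^ 2 / 2
    + t * (4 * lam ^ 2 * ((t ^ 2 + 1) ^ 2)⁻¹ + 4 * q') * x ^ 2 + z ^ 2

/-- The modified energy is coercive. -/
lemma le_modelEnergy {q' lam t x p z : ℝ} (hq : 0 ≤ q') (ht : 0 < t) (ht1 : t ≤ 1) :
    t⁻¹ * x ^ 2 + t * lam ^ 2 * x ^ 2 + t * p ^ 2 + z ^ 2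
      ≤ 6 * modelEnergy q' lam t x p z := by
  have hW : 1 ≤ 4 * ((t ^ 2 + 1) ^ 2)⁻¹ := by
    rw [← div_eq_mul_inv, le_div_iff₀ (by positivity)]
    nlinarith [pow_le_one₀ ht.le ht1 (n := 2), sq_nonneg t]
  have hV : t * lam ^ 2 * x ^ 2 ≤ 4 * ((t ^ 2 + 1) ^ 2)⁻¹ * (t * lam ^ 2 * x ^ 2) :=
    le_mul_of_one_le_left (by positivity) hW
  have hcross : 0 ≤ t * (3 * p + 2 * (t⁻¹ * x)) ^ 2 := by positivity
  have hinv : t * t⁻¹ = 1 := mul_inv_cancel₀ ht.ne'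
  have hexp : t * (3 * p + 2 * (t⁻¹ * x)) ^ 2
      = 9 * (t * p ^ 2) + 12 * (x * p) + 4 * (t⁻¹ * x ^ 2) := by
    linear_combination (12 * p * x + 4 * t⁻¹ * x ^ 2) * hinv
  have h1 : 0 ≤ t * q' * x ^ 2 := by positivity
  have h2 : 0 ≤ t * lam ^ 2 * x ^ 2 := by positivity
  have h3 : 0 ≤ t * p ^ 2 := by positivity
  have h4 : 0 ≤ t⁻¹ * x ^ 2 := by positivity
  unfold modelEnergy
  nlinarith [sq_nonneg z]

/-- Upper bound for the modified energy. -/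
lemma modelEnergy_le {q' lam t x p z : ℝ} (ht : 0 < t) :
    modelEnergy q' lam t x p z
      ≤ 3 / 2 * (t * p ^ 2) + t⁻¹ * x ^ 2 + 4 * (t * lam ^ 2 * x ^ 2)
        + 4 * (t * q' * x ^ 2) + z ^ 2 := by
  have hW : ((t ^ 2 + 1) ^ 2)⁻¹ ≤ 1 := inv_le_one_of_one_le₀ (by nlinarith [sq_nonneg t])
  have hV : ((t ^ 2 + 1) ^ 2)⁻¹ * (t * lam ^ 2 * x ^ 2) ≤ t * lam ^ 2 * x ^ 2 :=
    mul_le_of_le_one_left (by positivity) hW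
  have hcross : 0 ≤ t * (p - t⁻¹ * x) ^ 2 := by positivity
  have hinv : t * t⁻¹ = 1 := mul_inv_cancel₀ ht.ne'
  have hexp : t * (p - t⁻¹ * x) ^ 2 = t * p ^ 2 - 2 * (x * p) + t⁻¹ * x ^ 2 := by
    linear_combination (- 2 * p * x + t⁻¹ * x ^ 2) * hinv
  unfold modelEnergy
  nlinarith

/-- Bound for the source terms in the derivative of the modified energy. -/
lemma source_le {F g₁ g₂ g₃ t x p z : ℝ} (h₁ : |g₁| ≤ F) (h₂ : |g₂| ≤ F) (h₃ : |g₃| ≤ F)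
    (ht : 0 < t) (ht1 : t ≤ 1) :
    (g₁ * t * p + g₂ * t ^ 2 * x + g₃ * z) * (2 * t * p + x) + 4 * t * x * z
      ≤ (3 / 2 * F ^ 2 + 6) * (t⁻¹ * x ^ 2 + t * p ^ 2 + z ^ 2) := by
  set H := t⁻¹ * x ^ 2 + t * p ^ 2 + z ^ 2 with hH
  have hi : 1 ≤ t⁻¹ := (one_le_inv₀ ht).2 ht1
  have hx : x ^ 2 ≤ t⁻¹ * x ^ 2 := le_mul_of_one_le_left (sq_nonneg x) hi
  have hp : (t * p) ^ 2 ≤ t * p ^ 2 := by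
    have : t * (t * p ^ 2) ≤ t * p ^ 2 := mul_le_of_le_one_left (by positivity) ht1
    nlinarith
  have htx : (t ^ 2 * x) ^ 2 ≤ x ^ 2 := by
    have : (t ^ 2) ^ 2 ≤ 1 := pow_le_one₀ (by positivity) (pow_le_one₀ ht.le ht1)
    rw [mul_pow]
    exact mul_le_of_le_one_left (sq_nonneg x) this
  have key : ∀ g y : ℝ, |g| ≤ F → (g * y) ^ 2 ≤ F ^ 2 * y ^ 2 := fun g y hg => by
    rw [mul_pow]
    exact mul_le_mul_of_nonneg_right (sq_le_sq' (abs_le.1 hg).1 (abs_le.1 hg).2) (sq_nonneg y)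
  have hsum : F ^ 2 * (t * p) ^ 2 + F ^ 2 * (t ^ 2 * x) ^ 2 + F ^ 2 * z ^ 2 ≤ F ^ 2 * H := by
    rw [← mul_add, ← mul_add]
    exact mul_le_mul_of_nonneg_left (by linarith) (sq_nonneg F)
  have k1 := key g₁ (t * p) h₁
  have k2 := key g₂ (t ^ 2 * x) h₂
  have k3 := key g₃ z h₃
  set A := g₁ * (t * p)
  set B := g₂ * (t ^ 2 * x)
  set D := g₃ * z
  have e : g₁ * t * p + g₂ * t ^ 2 * x + g₃ * z = A + B + D := by ring
  have hR : (A + B + D) ^ 2 ≤ 3 * (F ^ 2 * H) := by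
    nlinarith [sq_nonneg (A - B), sq_nonneg (A - D), sq_nonneg (B - D)]
  have hS : (2 * t * p + x) ^ 2 ≤ 8 * H := by
    nlinarith [sq_nonneg (2 * t * p - x), sq_nonneg z]
  have hz : 4 * t * x * z ≤ 2 * H := by
    have h1 : (t * x) ^ 2 ≤ x ^ 2 := by
      rw [mul_pow]
      exact mul_le_of_le_one_left (sq_nonneg x) (pow_le_one₀ ht.le ht1)
    have h2 : 0 ≤ t * p ^ 2 := by positivity
    nlinarith [sq_nonneg (t * x - z)]
  rw [e]
  nlinarith [sq_nonneg (A + B + D - (2 * t * p + x))]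

/-- Along a solution, the modified energy satisfies a Grönwall differential inequality. -/
lemma exists_hasDerivAt_modelEnergy {q' F lam : ℝ} {f₁ f₂ f₃ a c : ℝ → ℝ} {I : Set ℝ}
    (hq : 0 ≤ q') (hsol : SolvesModelSystem q' f₁ f₂ f₃ lam a c I) {t : ℝ} (htI : t ∈ I)
    (h₁ : |f₁ t| ≤ F) (h₂ : |f₂ t| ≤ F) (h₃ : |f₃ t| ≤ F) (ht : 0 < t) (ht1 : t ≤ 1) :
    ∃ G', HasDerivAt (fun s => modelEnergy q' lam s (a s) (deriv a s) (c s)) G' t ∧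
      G' ≤ (9 * F ^ 2 + 36) * modelEnergy q' lam t (a t) (deriv a t) (c t) := by
  obtain ⟨da, dda, dc, hE, hC⟩ := hsol t htI
  have ha := da.hasDerivAt
  have hp := dda.hasDerivAt
  have hc := dc.hasDerivAt
  have hW := (((((hasDerivAt_id t).pow 2).add_const (1 : ℝ)).pow 2).inv
    (by simp only [id, Pi.pow_apply]; positivity))
  have hG := (((((hasDerivAt_id t).mul (hp.pow 2)).add (ha.mul hp)).add
    (((hasDerivAt_inv ht.ne').mul (ha.pow 2)).div_const 2)).add
    (((hasDerivAt_id t).mul ((hW.const_mul (4 * lam ^ 2)).add_const (4 * q'))).mul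
      (ha.pow 2))).add (hc.pow 2)
  refine ⟨_, hG, ?_⟩
  have hs := source_le (x := a t) (p := deriv a t) (z := c t) h₁ h₂ h₃ ht ht1
  have hl := le_modelEnergy (lam := lam) (x := a t) (p := deriv a t) (z := c t) hq ht ht1
  have hlam : 0 ≤ t * lam ^ 2 * a t ^ 2 := by positivity
  have hmul : (3 / 2 * F ^ 2 + 6) * (t⁻¹ * a t ^ 2 + t * deriv a t ^ 2 + c t ^ 2)
      ≤ (3 / 2 * F ^ 2 + 6) * (6 * modelEnergy q' lam t (a t) (deriv a t) (c t)) :=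
    mul_le_mul_of_nonneg_left (by linarith) (by positivity)
  have hgood : 0 ≤ (t⁻¹ * a t) ^ 2 / 2
      + 16 * lam ^ 2 * t ^ 2 * (t ^ 2 + 1) * (((t ^ 2 + 1) ^ 2) ^ 2)⁻¹ * a t ^ 2 := by
    positivity
  have hinv : t * t⁻¹ = 1 := mul_inv_cancel₀ ht.ne'
  rw [hC]
  simp only [id, Pi.pow_apply, Pi.mul_apply, Pi.inv_apply, Nat.cast_ofNat, Nat.add_one_sub_one,
    pow_one, mul_one, one_mul, div_eq_mul_inv, neg_mul] at *
  generalize deriv (deriv a) t = b at *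
  generalize deriv a t = p at *
  generalize a t = x at *
  refine le_trans (le_of_eq ?_) ((sub_le_self _ hgood).trans (hs.trans (hmul.trans
    (le_of_eq (by ring)))))
  linear_combination (2 * t * p + x) * hE - 2 * p ^ 2 * hinv

/-- High-frequency forward estimate (single-mode version of Proposition 3.3 of the paper). -/
theorem highFrequency_forward_estimate (q' F : ℝ) (hq : 1 ≤ q') (hF : 0 ≤ F) :
    ∃ C > 0, ∀ f₁ f₂ f₃ : ℝ → ℝ,
      ContinuousOn f₁ (Ici 0) → ContinuousOn f₂ (Ici 0) → ContinuousOn f₃ (Ici 0) →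
      (∀ τ ≥ (0:ℝ), |f₁ τ| ≤ F) → (∀ τ ≥ (0:ℝ), |f₂ τ| ≤ F) → (∀ τ ≥ (0:ℝ), |f₃ τ| ≤ F) →
      ∀ m lam : ℝ, 1 ≤ m → 0 ≤ lam →
      ∀ a c : ℝ → ℝ,
      SolvesModelSystem q' f₁ f₂ f₃ lam a c (Icc (1 / (2 * m)) 1) →
      ∀ τ ∈ Icc (1 / (2 * m)) 1,
        τ⁻¹ * a τ ^ 2 + τ * lam ^ 2 * a τ ^ 2 + τ * deriv a τ ^ 2
          ≤ (C / m) * (m ^ 2 * a (1 / (2 * m)) ^ 2 + lam ^ 2 * a (1 / (2 * m)) ^ 2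
              + deriv a (1 / (2 * m)) ^ 2 + m * c (1 / (2 * m)) ^ 2) := by
  set K := 9 * F ^ 2 + 36 with hK
  refine ⟨6 * Real.exp K * (2 + 2 * q'), by positivity, ?_⟩
  intro f₁ f₂ f₃ _ _ _ h₁ h₂ h₃ m lam hm _ a c hsol τ hτ
  have hm0 : 0 < m := by linarith
  set t₀ := 1 / (2 * m) with ht₀
  have ht₀pos : 0 < t₀ := by positivity
  have hτpos : 0 < τ := ht₀pos.trans_le hτ.1
  set G : ℝ → ℝ := fun s => modelEnergy q' lam s (a s) (deriv a s) (c s) with hG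
  have hderiv : ∀ t ∈ Icc t₀ 1, ∃ G', HasDerivAt G G' t ∧ G' ≤ K * G t := fun t ht => by
    have ht0 : 0 < t := ht₀pos.trans_le ht.1
    exact exists_hasDerivAt_modelEnergy (by linarith) hsol ht (h₁ t ht0.le) (h₂ t ht0.le)
      (h₃ t ht0.le) ht0 ht.2
  have hexp : ∀ t, HasDerivAt (fun s => Real.exp (-K * s)) (Real.exp (-K * t) * (-K)) t :=
    fun t => by simpa using ((hasDerivAt_id t).const_mul (-K)).exp
  have hanti : AntitoneOn (fun s => Real.exp (-K * s) * G s) (Icc t₀ 1) := by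
    refine antitoneOn_of_deriv_nonpos (convex_Icc _ _) (fun t ht => ?_) (fun t ht => ?_)
      (fun t ht => ?_)
    · obtain ⟨G', hG', -⟩ := hderiv t ht
      exact ((hexp t).mul hG').continuousAt.continuousWithinAt
    · obtain ⟨G', hG', -⟩ := hderiv t (interior_subset ht)
      exact ((hexp t).mul hG').differentiableAt.differentiableWithinAt
    · obtain ⟨G', hG', hle⟩ := hderiv t (interior_subset ht)
      have := ((hexp t).mul hG').deriv
      change deriv (fun s => Real.exp (-K * s) * G s) t = _ at this
      rw [this]
      nlinarith [Real.exp_pos (-K * t)]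
  have hle := hanti ⟨le_rfl, hτ.1.trans hτ.2⟩ hτ hτ.1
  have hlow := le_modelEnergy (q' := q') (lam := lam) (x := a τ) (p := deriv a τ) (z := c τ)
    (by linarith) hτpos hτ.2
  have hup := modelEnergy_le (q' := q') (lam := lam) (x := a t₀) (p := deriv a t₀) (z := c t₀)
    ht₀pos
  have hG0 : 0 ≤ G t₀ := by
    have := le_modelEnergy (q' := q') (lam := lam) (x := a t₀) (p := deriv a t₀) (z := c t₀)
      (by linarith) ht₀pos (hτ.1.trans hτ.2)
    have : 0 ≤ t₀⁻¹ * a t₀ ^ 2 + t₀ * lam ^ 2 * a t₀ ^ 2 + t₀ * deriv a t₀ ^ 2 + c t₀ ^ 2 := by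
      positivity
    simp only [hG]
    linarith
  have hgron : G τ ≤ Real.exp K * G t₀ := by
    have hK0 : 0 ≤ K := by positivity
    have h1 : G τ = Real.exp (K * τ) * (Real.exp (-K * τ) * G τ) := by
      rw [← mul_assoc, ← Real.exp_add]
      simp
    have h2 : Real.exp (-K * t₀) * G t₀ ≤ G t₀ :=
      mul_le_of_le_one_left hG0 (Real.exp_le_one_iff.2 (by nlinarith))
    rw [h1]
    exact mul_le_mul (Real.exp_le_exp.2 (by nlinarith [hτ.2])) (hle.trans h2)
      (by
        have : 0 ≤ G τ := by
          have : 0 ≤ τ⁻¹ * a τ ^ 2 + τ * lam ^ 2 * a τ ^ 2 + τ * deriv a τ ^ 2 + c τ ^ 2 := by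
            positivity
          simp only [hG]
          linarith
        positivity) (Real.exp_pos _).le
  have hdata : G t₀ ≤ (2 + 2 * q') / m * (m ^ 2 * a t₀ ^ 2 + lam ^ 2 * a t₀ ^ 2
      + deriv a t₀ ^ 2 + m * c t₀ ^ 2) := by
    refine hup.trans ?_
    have hinv : t₀⁻¹ = 2 * m := by simp [ht₀]
    rw [hinv, div_mul_eq_mul_div (2 + 2 * q'), le_div_iff₀ hm0]
    have htm : t₀ * m = 1 / 2 := by rw [ht₀]; field_simp
    generalize a t₀ = x at *
    generalize deriv a t₀ = p at *
    generalize c t₀ = z at *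
    have e : (3 / 2 * (t₀ * p ^ 2) + 2 * m * x ^ 2 + 4 * (t₀ * lam ^ 2 * x ^ 2)
        + 4 * (t₀ * q' * x ^ 2) + z ^ 2) * m
        = 3 / 4 * p ^ 2 + 2 * (m ^ 2 * x ^ 2) + 2 * (lam ^ 2 * x ^ 2)
          + 2 * (q' * x ^ 2) + m * z ^ 2 := by
      linear_combination (3 / 2 * p ^ 2 + 4 * lam ^ 2 * x ^ 2 + 4 * q' * x ^ 2) * htm
    have hq0 : 0 ≤ q' := by linarith
    have i1 : q' * x ^ 2 ≤ q' * (m ^ 2 * x ^ 2) :=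
      mul_le_mul_of_nonneg_left (le_mul_of_one_le_left (sq_nonneg x) (one_le_pow₀ hm)) hq0
    have i2 : 0 ≤ q' * (lam ^ 2 * x ^ 2) := by positivity
    have i3 : 0 ≤ q' * p ^ 2 := by positivity
    have i4 : 0 ≤ q' * (m * z ^ 2) := by positivity
    have i5 : 0 ≤ m * z ^ 2 := by positivity
    rw [e]
    nlinarith [sq_nonneg p]
  calc τ⁻¹ * a τ ^ 2 + τ * lam ^ 2 * a τ ^ 2 + τ * deriv a τ ^ 2
      ≤ 6 * G τ := by simp only [hG]; linarith [sq_nonneg (c τ)]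
    _ ≤ 6 * (Real.exp K * ((2 + 2 * q') / m * (m ^ 2 * a t₀ ^ 2 + lam ^ 2 * a t₀ ^ 2
      + deriv a t₀ ^ 2 + m * c t₀ ^ 2))) := by
        have := mul_le_mul_of_nonneg_left hdata (Real.exp_pos K).le
        linarith
    _ = _ := by ring
end

section
/- There exists a constant C > 0, depending only on q' and F, such that the following holds. For every m ≥ 1, every λ ≥ 0, and every pair (a, c) solving the mode-λ model system on (0,∞) with asymptotic data (c₀, O, O·log m) at τ = 0, one has: (1+λ²)·a(1)² + a'(1)² ≤ C·( m·O² + m⁻¹·λ²·O² + c₀² ). (This is the single spherical-harmonic-mode version of the paper's Corollary 3.5, the forward estimate for the singular component α_Y at τ = 1.) -/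
open Set Filter

/-- The Grönwall inequality with a source term `s`, the derivative of `S`, and with the initial values
taken as one-sided limits. -/
theorem gronwall_of_tendsto {H H' S s : ℝ → ℝ} {x T k H0 S0 : ℝ} (hxT : x < T) (hk : 0 ≤ k)
    (hH : ∀ t ∈ Ioc x T, HasDerivAt H (H' t) t) (hS : ∀ t ∈ Ioc x T, HasDerivAt S (s t) t)
    (hs : ∀ t ∈ Ioc x T, 0 ≤ s t) (hle : ∀ t ∈ Ioc x T, H' t ≤ k * H t + s t)
    (hH0 : Tendsto H (nhdsWithin x (Ioi x)) (nhds H0))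
    (hS0 : Tendsto S (nhdsWithin x (Ioi x)) (nhds S0)) :
    H T ≤ Real.exp (k * (T - x)) * (H0 + (S T - S0)) := by
  set G : ℝ → ℝ := fun t => Real.exp (-(k * (t - x))) * H t - S t with hG
  have hd : ∀ t ∈ Ioc x T, HasDerivAt G
      (Real.exp (-(k * (t - x))) * (-(k * 1)) * H t + Real.exp (-(k * (t - x))) * H' t - s t) t := by
    intro t ht
    have h1 : HasDerivAt (fun t => -(k * (t - x))) (-(k * 1)) t :=
      (((hasDerivAt_id t).sub_const x).const_mul k).neg
    exact (h1.exp.mul (hH t ht)).sub (hS t ht)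
  have hanti : AntitoneOn G (Ioc x T) := by
    refine antitoneOn_of_deriv_nonpos (convex_Ioc x T)
      (fun t ht => (hd t ht).continuousAt.continuousWithinAt)
      (fun t ht => (hd t (interior_subset ht)).differentiableAt.differentiableWithinAt) ?_
    intro t ht
    have ht' := interior_subset ht
    rw [(hd t ht').deriv]
    have he : Real.exp (-(k * (t - x))) ≤ 1 := by
      apply Real.exp_le_one_iff.2
      have : 0 ≤ k * (t - x) := mul_nonneg hk (by linarith [ht'.1])
      linarith
    have h2 := mul_le_mul_of_nonneg_left (hle t ht') (Real.exp_pos (-(k * (t - x)))).le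
    have h3 := mul_le_mul_of_nonneg_right he (hs t ht')
    nlinarith
  have hlim : Tendsto G (nhdsWithin x (Ioi x)) (nhds (1 * H0 - S0)) := by
    refine Tendsto.sub (Tendsto.mul ?_ hH0) hS0
    have : ContinuousAt (fun t => Real.exp (-(k * (t - x)))) x := by fun_prop
    have h := this.tendsto.mono_left (nhdsWithin_le_nhds (s := Ioi x))
    simpa using h
  have hfin : G T ≤ 1 * H0 - S0 := by
    refine ge_of_tendsto hlim ?_
    filter_upwards [Ioc_mem_nhdsGT hxT] with t ht
    exact hanti ht ⟨hxT, le_rfl⟩ ht.2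
  have hmul := mul_le_mul_of_nonneg_left hfin (Real.exp_pos (k * (T - x))).le
  have hexp : Real.exp (k * (T - x)) * Real.exp (-(k * (T - x))) = 1 := by
    rw [← Real.exp_add]; simp
  have : Real.exp (k * (T - x)) * G T
      = H T - Real.exp (k * (T - x)) * S T := by
    simp only [hG]; linear_combination H T * hexp
  rw [this] at hmul
  linarith

theorem tendsto_mul_log_nhdsGT_zero :
    Tendsto (fun t : ℝ => t * Real.log t) (nhdsWithin 0 (Ioi 0)) (nhds 0) := by
  have h := Real.continuous_mul_log.tendsto 0
  simpa using h.mono_left (nhdsWithin_le_nhds (s := Ioi 0))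

theorem tendsto_mul_log_sq_nhdsGT_zero :
    Tendsto (fun t : ℝ => t * Real.log t ^ 2) (nhdsWithin 0 (Ioi 0)) (nhds 0) := by
  have h := (tendsto_log_mul_rpow_nhdsGT_zero (r := 1 / 2) (by norm_num)).pow 2
  rw [zero_pow two_ne_zero] at h
  refine h.congr' ?_
  filter_upwards [self_mem_nhdsWithin] with t ht
  have ht : (0 : ℝ) < t := ht
  rw [mul_pow, ← Real.sqrt_eq_rpow, Real.sq_sqrt ht.le]
  ring

theorem one_add_log_sq_le {x : ℝ} (hx : 0 < x) : 1 + Real.log x ^ 2 ≤ 2 * (x + x⁻¹) := by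
  have key : ∀ y : ℝ, 0 ≤ y → 1 + y ^ 2 ≤ 2 * (Real.exp y + Real.exp (-y)) := by
    intro y hy
    have h1 := Real.quadratic_le_exp_of_nonneg hy
    have h2 := Real.add_one_le_exp (-y)
    nlinarith
  have hx1 : Real.exp (Real.log x) = x := Real.exp_log hx
  have hx2 : Real.exp (-Real.log x) = x⁻¹ := by rw [Real.exp_neg, hx1]
  rcases le_total 0 (Real.log x) with h | h
  · simpa [hx1, hx2] using key _ h
  · have := key (-Real.log x) (by linarith)
    rw [neg_neg, hx1, hx2] at this
    nlinarith

theorem log_term_le (O : ℝ) {m lam : ℝ} (hm : 1 ≤ m) (hlam : 0 ≤ lam) :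
    (2 + lam) * O ^ 2 * (1 + Real.log ((2 + lam)⁻¹ * m) ^ 2)
      ≤ 18 * (m * O ^ 2 + lam ^ 2 * O ^ 2 / m) := by
  have hm0 : 0 < m := by linarith
  have hN0 : 0 < 2 + lam := by linarith
  have h := one_add_log_sq_le (mul_pos (inv_pos.2 hN0) hm0)
  have e1 := mul_le_mul_of_nonneg_left h (by positivity : 0 ≤ (2 + lam) * O ^ 2)
  have e2 : (2 + lam) * O ^ 2 * (2 * ((2 + lam)⁻¹ * m + ((2 + lam)⁻¹ * m)⁻¹))
      = 2 * (m * O ^ 2 + (2 + lam) ^ 2 * (O ^ 2 / m)) := by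
    field_simp
  have e3 : (2 + lam) ^ 2 ≤ 8 + 2 * lam ^ 2 := by linarith [sq_nonneg (lam - 2)]
  have e4 : O ^ 2 / m ≤ m * O ^ 2 :=
    (div_le_self (sq_nonneg O) hm).trans (le_mul_of_one_le_left (sq_nonneg O) hm)
  have e5 : 0 ≤ O ^ 2 / m := by positivity
  have e6 : lam ^ 2 * O ^ 2 / m = lam ^ 2 * (O ^ 2 / m) := by ring
  have e7 := mul_le_mul_of_nonneg_right e3 e5
  have e8 : 0 ≤ lam ^ 2 * (O ^ 2 / m) := by positivity
  rw [e6]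
  linarith

/-- The pointwise differential inequality for the energy of the regular part near `τ = 0`. -/
theorem near_energy_deriv_le {q' F N t V R g c O L f₁ f₂ f₃ : ℝ} (hq : 1 ≤ q') (hF : 0 ≤ F)
    (hN : 2 ≤ N) (ht : 0 < t) (htN : t * N ≤ 1) (hV : 0 ≤ V) (hVN : V ≤ 4 * q' * N ^ 2)
    (h₁ : |f₁| ≤ F) (h₂ : |f₂| ≤ F) (h₃ : |f₃| ≤ F) :
    2 * R * (-(R / t) - V * (g + O * L) + f₁ * (t * R + O) + f₂ * t ^ 2 * (g + O * L) + f₃ * c)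
      + 2 * N ^ 2 * g * R + N * (2 * c * (2 * t * (g + O * L)))
      ≤ N * (2 * (4 * q' + F) + 5 * F + 5) * (R ^ 2 + N ^ 2 * g ^ 2 + N * c ^ 2)
        + N ^ 3 * O ^ 2 * (4 * q' + 2 * F + 4) * (L ^ 2 + 1) := by
  have ht1 : t ≤ 1 := by nlinarith
  have ht2 : t ^ 2 ≤ 1 := by nlinarith
  have hN0 : 0 < N := by linarith
  have hN2 : 1 ≤ N ^ 2 := by nlinarith
  set A := 4 * q' + F with hA
  have hA0 : 0 ≤ A := by positivity
  set X := |R| with hX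
  set u := N * |g| with hu
  set v := N * |O * L| with hv
  have hX0 : 0 ≤ X := abs_nonneg R
  have hu0 : 0 ≤ u := by positivity
  have hv0 : 0 ≤ v := by positivity
  have hXsq : X ^ 2 = R ^ 2 := sq_abs R
  have husq : u ^ 2 = N ^ 2 * g ^ 2 := by rw [hu, mul_pow, sq_abs]
  have hvsq : v ^ 2 = N ^ 2 * (O ^ 2 * L ^ 2) := by rw [hv, mul_pow, sq_abs, mul_pow]
  have hpot : 2 * R * ((-V + f₂ * t ^ 2) * (g + O * L)) ≤ 2 * A * N * X * (u + v) := by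
    have hcoef : |-V + f₂ * t ^ 2| ≤ A * N ^ 2 := by
      calc |-V + f₂ * t ^ 2| ≤ |-V| + |f₂ * t ^ 2| := abs_add_le _ _
        _ = V + |f₂| * t ^ 2 := by rw [abs_neg, abs_of_nonneg hV, abs_mul, abs_of_nonneg (sq_nonneg t)]
        _ ≤ 4 * q' * N ^ 2 + F * N ^ 2 := by
          have : |f₂| * t ^ 2 ≤ F * N ^ 2 :=
            mul_le_mul h₂ (by linarith) (sq_nonneg t) hF
          linarith
        _ = A * N ^ 2 := by rw [hA]; ring
    calc 2 * R * ((-V + f₂ * t ^ 2) * (g + O * L))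
        ≤ |2 * R * ((-V + f₂ * t ^ 2) * (g + O * L))| := le_abs_self _
      _ = 2 * X * (|-V + f₂ * t ^ 2| * |g + O * L|) := by
        rw [abs_mul, abs_mul, abs_mul, abs_two]
      _ ≤ 2 * X * (A * N ^ 2 * (|g| + |O * L|)) := by
        gcongr
        exact abs_add_le _ _
      _ = 2 * A * N * X * (u + v) := by rw [hu, hv]; ring
  have hpot2 : 2 * A * N * X * (u + v) ≤ A * N * (2 * X ^ 2 + u ^ 2 + v ^ 2) := by
    have : 0 ≤ A * N * ((X - u) ^ 2 + (X - v) ^ 2) := by positivity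
    linarith
  have hf1 : 2 * R * (f₁ * (t * R + O)) ≤ F * (3 * X ^ 2 + O ^ 2) := by
    have e1 : 2 * R * (f₁ * (t * R + O)) ≤ 2 * X * (F * (X + |O|)) := by
      calc 2 * R * (f₁ * (t * R + O)) ≤ |2 * R * (f₁ * (t * R + O))| := le_abs_self _
        _ = 2 * X * (|f₁| * |t * R + O|) := by rw [abs_mul, abs_mul, abs_mul, abs_two]
        _ ≤ 2 * X * (F * (X + |O|)) := by
          gcongr
          refine (abs_add_le _ _).trans ?_
          rw [abs_mul, abs_of_pos ht]
          have := mul_le_mul_of_nonneg_right ht1 hX0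
          linarith
    have e2 : 0 ≤ F * (X - |O|) ^ 2 := by positivity
    rw [sub_sq, sq_abs O] at e2
    linarith
  have hf3 : 2 * R * (f₃ * c) ≤ F * (X ^ 2 + c ^ 2) := by
    have e1 : 2 * R * (f₃ * c) ≤ 2 * X * (F * |c|) := by
      calc 2 * R * (f₃ * c) ≤ |2 * R * (f₃ * c)| := le_abs_self _
        _ = 2 * X * (|f₃| * |c|) := by rw [abs_mul, abs_mul, abs_mul, abs_two]
        _ ≤ 2 * X * (F * |c|) := by gcongr
    have e2 : 0 ≤ F * (X - |c|) ^ 2 := by positivity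
    rw [sub_sq, sq_abs c] at e2
    linarith
  have hgr : 2 * N ^ 2 * g * R ≤ N * (X ^ 2 + u ^ 2) := by
    rw [hXsq, husq]
    have : 0 ≤ N * (R - N * g) ^ 2 := by positivity
    linarith
  have hc : N * (2 * c * (2 * t * (g + O * L))) ≤ 2 * c ^ 2 + u ^ 2 + v ^ 2 := by
    have e1 : N * (2 * c * (2 * t * (g + O * L))) ≤ 4 * (|c| * |g + O * L|) := by
      calc N * (2 * c * (2 * t * (g + O * L))) = (t * N) * (4 * (c * (g + O * L))) := by ring
        _ ≤ (t * N) * (4 * |c * (g + O * L)|) := by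
          gcongr
          exact le_abs_self _
        _ ≤ 1 * (4 * |c * (g + O * L)|) := by gcongr
        _ = 4 * (|c| * |g + O * L|) := by rw [abs_mul, one_mul]
    have e2 : 4 * (|c| * |g + O * L|) ≤ 2 * c ^ 2 + 2 * (g + O * L) ^ 2 := by
      rw [← sq_abs c, ← sq_abs (g + O * L)]
      linarith [sq_nonneg (|c| - |g + O * L|)]
    have e3 : 2 * (g + O * L) ^ 2 ≤ 4 * (g ^ 2 + O ^ 2 * L ^ 2) := by
      linarith [sq_nonneg (g - O * L)]
    have e4 : 4 * (g ^ 2 + O ^ 2 * L ^ 2) ≤ N ^ 2 * (g ^ 2 + O ^ 2 * L ^ 2) := by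
      have : 4 ≤ N ^ 2 := by nlinarith
      gcongr
    rw [husq, hvsq]
    linarith
  have hdamp : 0 ≤ 2 * R * (R / t) := by
    have : 2 * R * (R / t) = 2 * R ^ 2 / t := by ring
    rw [this]; positivity
  have hsum : 2 * R * (-(R / t) - V * (g + O * L) + f₁ * (t * R + O) + f₂ * t ^ 2 * (g + O * L)
      + f₃ * c) + 2 * N ^ 2 * g * R + N * (2 * c * (2 * t * (g + O * L)))
      ≤ A * N * (2 * X ^ 2 + u ^ 2 + v ^ 2) + F * (3 * X ^ 2 + O ^ 2) + F * (X ^ 2 + c ^ 2)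
        + N * (X ^ 2 + u ^ 2) + (2 * c ^ 2 + u ^ 2 + v ^ 2) := by
    linarith
  refine hsum.trans ?_
  have hNF : F ≤ N * F := le_mul_of_one_le_left hF (by linarith)
  have k1 : F * (4 * X ^ 2 + c ^ 2) ≤ N * F * (4 * X ^ 2 + N * c ^ 2) := by
    have : c ^ 2 ≤ N * c ^ 2 := le_mul_of_one_le_left (sq_nonneg c) (by linarith)
    gcongr
  have k2 : F * O ^ 2 ≤ N ^ 3 * F * O ^ 2 := by
    have : 1 ≤ N ^ 3 := one_le_pow₀ (by linarith)
    have := mul_le_mul_of_nonneg_right this (mul_nonneg hF (sq_nonneg O))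
    linarith
  have k3 : u ^ 2 + v ^ 2 + 2 * c ^ 2 ≤ N * (u ^ 2 + v ^ 2 + 2 * (N * c ^ 2)) := by
    have h1 : c ^ 2 ≤ N * c ^ 2 := le_mul_of_one_le_left (sq_nonneg c) (by linarith)
    have h2 : 0 ≤ u ^ 2 + v ^ 2 + 2 * (N * c ^ 2) := by positivity
    have h3 := le_mul_of_one_le_left h2 (by linarith : 1 ≤ N)
    linarith
  have hpos : 0 ≤ N ^ 3 * O ^ 2 * (F * L ^ 2 + 3 * L ^ 2 + (4 * q' + F + 4)) := by positivity
  have hpos2 : 0 ≤ N * A * (2 * (N * c ^ 2) + u ^ 2)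
      + N * F * (X ^ 2 + 5 * u ^ 2 + 4 * (N * c ^ 2))
      + N * (4 * X ^ 2 + 3 * u ^ 2 + 3 * (N * c ^ 2)) := by positivity
  have hv3 : N * v ^ 2 = N ^ 3 * O ^ 2 * L ^ 2 := by rw [hvsq]; ring
  have hAv : A * N * v ^ 2 = A * (N ^ 3 * O ^ 2 * L ^ 2) := by rw [← hv3]; ring
  rw [← hXsq, ← husq]
  have hq4 : 4 * q' = A - F := by rw [hA]; ring
  rw [hq4] at hpos ⊢
  linarith

/-- The pointwise differential inequality for the energy away from `τ = 0`. -/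
theorem far_energy_deriv_le {F t E a p c W f₁ f₂ f₃ : ℝ} (hF : 0 ≤ F) (ht : 0 < t) (ht1 : t ≤ 1)
    (hW : W ≤ 0) (h₁ : |f₁| ≤ F) (h₂ : |f₂| ≤ F) (h₃ : |f₃| ≤ F)
    (hE : t * p ^ 2 + a * p + a ^ 2 / (2 * t) ≤ E) :
    (2 * t * p + a) * (f₁ * t * p + f₂ * t ^ 2 * a + f₃ * c) - a ^ 2 / (2 * t ^ 2) + t * W * a ^ 2
      + 2 * c * (2 * t * a) ≤ (11 * F + 8) * (E + c ^ 2) := by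
  set X := t * p + a / 2 with hX
  have hXE : X ^ 2 + a ^ 2 / 4 ≤ t * E := by
    have := mul_le_mul_of_nonneg_left hE ht.le
    have e : t * (t * p ^ 2 + a * p + a ^ 2 / (2 * t)) = X ^ 2 + a ^ 2 / 4 := by
      rw [hX]; field_simp; ring
    linarith
  have hE0 : 0 ≤ E := by
    by_contra! h
    nlinarith [sq_nonneg X, sq_nonneg a]
  have hXE' : X ^ 2 + a ^ 2 / 4 ≤ E := by nlinarith
  have hρ : |f₁ * t * p + f₂ * t ^ 2 * a + f₃ * c| ≤ F * (|X| + 3 / 2 * |a| + |c|) := by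
    have e : f₁ * t * p + f₂ * t ^ 2 * a + f₃ * c
        = f₁ * (X - a / 2) + f₂ * (t ^ 2 * a) + f₃ * c := by rw [hX]; ring
    have b1 : |X - a / 2| ≤ |X| + |a| / 2 := by
      refine (abs_sub X (a / 2)).trans ?_
      rw [abs_div, abs_two]
    have b2 : |t ^ 2 * a| ≤ |a| := by
      rw [abs_mul, abs_of_nonneg (sq_nonneg t)]
      have : t ^ 2 ≤ 1 := by nlinarith
      nlinarith [abs_nonneg a]
    rw [e]
    calc |f₁ * (X - a / 2) + f₂ * (t ^ 2 * a) + f₃ * c|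
        ≤ |f₁ * (X - a / 2)| + |f₂ * (t ^ 2 * a)| + |f₃ * c| := abs_add_three _ _ _
      _ = |f₁| * |X - a / 2| + |f₂| * |t ^ 2 * a| + |f₃| * |c| := by simp only [abs_mul]
      _ ≤ F * (|X| + |a| / 2) + F * |a| + F * |c| := by gcongr
      _ = F * (|X| + 3 / 2 * |a| + |c|) := by ring
  have hmain : (2 * t * p + a) * (f₁ * t * p + f₂ * t ^ 2 * a + f₃ * c)
      ≤ 2 * |X| * (F * (|X| + 3 / 2 * |a| + |c|)) := by
    calc (2 * t * p + a) * (f₁ * t * p + f₂ * t ^ 2 * a + f₃ * c)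
        = 2 * X * (f₁ * t * p + f₂ * t ^ 2 * a + f₃ * c) := by rw [hX]; ring
      _ ≤ |2 * X * (f₁ * t * p + f₂ * t ^ 2 * a + f₃ * c)| := le_abs_self _
      _ = 2 * |X| * |f₁ * t * p + f₂ * t ^ 2 * a + f₃ * c| := by rw [abs_mul, abs_mul, abs_two]
      _ ≤ _ := by gcongr
  have hquad : 2 * |X| * (|X| + 3 / 2 * |a| + |c|) ≤ 11 * (E + c ^ 2) := by
    nlinarith [sq_nonneg (|X| - |a|), sq_nonneg (|X| - |c|), sq_abs X, sq_abs a, sq_abs c]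
  have hquad' := mul_le_mul_of_nonneg_left hquad hF
  have hca : 2 * c * (2 * t * a) ≤ 8 * (E + c ^ 2) := by
    have e1 : 2 * c * (2 * t * a) ≤ 2 * (c ^ 2 + t ^ 2 * a ^ 2) := by
      nlinarith [sq_nonneg (c - t * a)]
    have e2 : t ^ 2 * a ^ 2 ≤ a ^ 2 := by
      have : t ^ 2 ≤ 1 := by nlinarith
      nlinarith [sq_nonneg a]
    nlinarith [sq_nonneg X, sq_nonneg c]
  have hneg : 0 ≤ a ^ 2 / (2 * t ^ 2) := by positivity
  have hW' : t * W * a ^ 2 ≤ 0 :=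
    mul_nonpos_of_nonpos_of_nonneg (mul_nonpos_of_nonneg_of_nonpos ht.le hW) (sq_nonneg a)
  linarith

/-- The bound at `τ = 1 / (2 + lam)` for the regular part of a solution with logarithmic data. -/
theorem near_energy_le {q' F : ℝ} (hq : 1 ≤ q') (hF : 0 ≤ F) {f₁ f₂ f₃ : ℝ → ℝ}
    (h₁ : ∀ τ ≥ (0 : ℝ), |f₁ τ| ≤ F) (h₂ : ∀ τ ≥ (0 : ℝ), |f₂ τ| ≤ F)
    (h₃ : ∀ τ ≥ (0 : ℝ), |f₃ τ| ≤ F) {lam h c₀ O : ℝ} (hlam : 0 ≤ lam) {a c : ℝ → ℝ}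
    (hsol : SolvesModelSystem q' f₁ f₂ f₃ lam a c (Ioi 0))
    (hdata : HasAsymptoticData a c c₀ O (O * h)) {N T : ℝ} (hN : N = 2 + lam) (hT : T * N = 1) :
    (deriv a T - O / T) ^ 2 + N ^ 2 * (a T - O * (Real.log T + h)) ^ 2 + N * c T ^ 2
      ≤ Real.exp (2 * (4 * q' + F) + 5 * F + 5) *
        (N * c₀ ^ 2 + N ^ 2 * O ^ 2 * (4 * q' + 2 * F + 4) * (2 * (Real.log T + h) ^ 2 + 4)) := by
  have hN2 : 2 ≤ N := by linarith
  have hN0 : 0 < N := by linarith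
  have hT0 : 0 < T := by
    by_contra! hh
    nlinarith
  obtain ⟨hcc, hc0, K, hK, hasym⟩ := hdata
  set B := 4 * q' + 2 * F + 4 with hB
  have hB0 : 0 ≤ B := by positivity
  set κ := 2 * (4 * q' + F) + 5 * F + 5 with hκ
  have hκ0 : 0 ≤ κ := by positivity
  have hlogd : ∀ t : ℝ, 0 < t → HasDerivAt (fun t => Real.log t + h) t⁻¹ t := fun t ht =>
    (Real.hasDerivAt_log ht.ne').add_const h
  have key := gronwall_of_tendsto (x := 0) (T := T) (k := N * κ)
    (H := fun t => (deriv a t - O / t) ^ 2 + N ^ 2 * (a t - O * (Real.log t + h)) ^ 2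
      + N * c t ^ 2)
    (H' := fun t => 2 * (deriv a t - O / t) * (deriv (deriv a) t + O / t ^ 2)
      + N ^ 2 * (2 * (a t - O * (Real.log t + h)) * (deriv a t - O * t⁻¹))
      + N * (2 * c t * deriv c t))
    (S := fun t => N ^ 3 * O ^ 2 * B * (t * ((Real.log t + h - 1) ^ 2 + 2)))
    (s := fun t => N ^ 3 * O ^ 2 * B * ((Real.log t + h) ^ 2 + 1))
    (H0 := N * c₀ ^ 2) (S0 := 0) hT0 (by positivity) ?_ ?_ ?_ ?_ ?_ ?_
  · have e1 : N * κ * (T - 0) = κ := by linear_combination κ * hT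
    rw [e1] at key
    refine key.trans ?_
    gcongr
    have e2 : N ^ 3 * O ^ 2 * B * (T * ((Real.log T + h - 1) ^ 2 + 2)) - 0
        = N ^ 2 * O ^ 2 * B * ((Real.log T + h - 1) ^ 2 + 2) := by
      linear_combination N ^ 2 * O ^ 2 * B * ((Real.log T + h - 1) ^ 2 + 2) * hT
    rw [e2]
    refine mul_le_mul_of_nonneg_left ?_ (by positivity)
    linarith [sq_nonneg (Real.log T + h + 1)]
  · intro t ht
    obtain ⟨ha, ha', hc, -, -⟩ := hsol t ht.1
    have ht0 : t ≠ 0 := ht.1.ne'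
    have hR : HasDerivAt (fun t => deriv a t - O / t) (deriv (deriv a) t + O / t ^ 2) t := by
      refine (ha'.hasDerivAt.sub ((hasDerivAt_inv ht0).const_mul O)).congr_deriv ?_
      ring
    have hg : HasDerivAt (fun t => a t - O * (Real.log t + h)) (deriv a t - O * t⁻¹) t :=
      ha.hasDerivAt.sub ((hlogd t ht.1).const_mul O)
    refine (((hR.pow 2).add ((hg.pow 2).const_mul (N ^ 2))).add
      ((hc.hasDerivAt.pow 2).const_mul N)).congr_deriv ?_
    push_cast
    ring
  · intro t ht
    have ht0 : t ≠ 0 := ht.1.ne'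
    refine (((hasDerivAt_id t).mul
      ((((hlogd t ht.1).sub_const 1).pow 2).add_const 2)).const_mul _).congr_deriv ?_
    simp only [id, Pi.pow_apply]
    push_cast
    field_simp
    ring
  · intro t _
    positivity
  · intro t ht
    obtain ⟨-, -, -, hE, hC⟩ := hsol t ht.1
    have ht0 : t ≠ 0 := ht.1.ne'
    have htN : t * N ≤ 1 := by
      have := mul_le_mul_of_nonneg_right ht.2 hN0.le
      linarith
    have hVle : ((t ^ 2 + 1) ^ 2)⁻¹ ≤ 1 := inv_le_one_of_one_le₀ (by nlinarith [sq_nonneg t])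
    have hinv0 : 0 ≤ ((t ^ 2 + 1) ^ 2)⁻¹ := by positivity
    have := near_energy_deriv_le (N := N) (t := t)
      (V := 4 * q' + 4 * lam ^ 2 * ((t ^ 2 + 1) ^ 2)⁻¹) (R := deriv a t - O / t)
      (g := a t - O * (Real.log t + h)) (c := c t) (O := O) (L := Real.log t + h)
      hq hF hN2 ht.1 htN (by positivity) ?_ (h₁ t ht.1.le) (h₂ t ht.1.le) (h₃ t ht.1.le)
    · rw [← hκ, ← hB] at this
      refine le_trans (le_of_eq ?_) this
      have ha'' : deriv (deriv a) t = -(t⁻¹ * deriv a t) - 4 * q' * a t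
          - 4 * lam ^ 2 * ((t ^ 2 + 1) ^ 2)⁻¹ * a t
          + (f₁ t * t * deriv a t + f₂ t * t ^ 2 * a t + f₃ t * c t) := by linarith
      rw [hC, ha'']
      have hOt : t * (deriv a t - O / t) = t * deriv a t - O := by field_simp
      have hdt : (deriv a t - O / t) / t = t⁻¹ * deriv a t - O / t ^ 2 := by field_simp
      rw [hOt, hdt]
      ring
    · have : lam ^ 2 * ((t ^ 2 + 1) ^ 2)⁻¹ ≤ lam ^ 2 :=
        mul_le_of_le_one_right (sq_nonneg _) hVle
      have hN' : 1 + lam ^ 2 ≤ N ^ 2 := by rw [hN]; nlinarith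
      have hl : lam ^ 2 ≤ q' * lam ^ 2 := by nlinarith [sq_nonneg lam]
      nlinarith
  · have hlim1 : Tendsto (fun t : ℝ => K * t * (1 + Real.log t ^ 2))
        (nhdsWithin 0 (Ioi 0)) (nhds 0) := by
      have h0 : Tendsto (fun t : ℝ => t) (nhdsWithin 0 (Ioi 0)) (nhds 0) :=
        tendsto_id.mono_left nhdsWithin_le_nhds
      have := (h0.add tendsto_mul_log_sq_nhdsGT_zero).const_mul K
      rw [add_zero, mul_zero] at this
      exact this.congr fun t => by ring
    have hR0 : Tendsto (fun t => deriv a t - O / t) (nhdsWithin 0 (Ioi 0)) (nhds 0) := by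
      refine squeeze_zero_norm' ?_ hlim1
      filter_upwards [Ioc_mem_nhdsGT zero_lt_one] with t ht
      exact (hasym t ht).2
    have hg0 : Tendsto (fun t => a t - O * (Real.log t + h)) (nhdsWithin 0 (Ioi 0)) (nhds 0) := by
      refine squeeze_zero_norm' ?_ hlim1
      filter_upwards [Ioc_mem_nhdsGT zero_lt_one] with t ht
      have h1 := (hasym t ht).1
      rw [Real.norm_eq_abs, mul_add, ← sub_sub]
      refine h1.trans ?_
      have : t ^ 2 ≤ t := by nlinarith [ht.1, ht.2]
      gcongr
    have hc0' : Tendsto c (nhdsWithin 0 (Ioi 0)) (nhds c₀) := by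
      have := (hcc 0 (by simp)).tendsto.mono_left (nhdsWithin_mono 0 Ioi_subset_Ici_self)
      rwa [hc0] at this
    have := ((hR0.pow 2).add ((hg0.pow 2).const_mul (N ^ 2))).add ((hc0'.pow 2).const_mul N)
    simpa using this
  · have h0 : Tendsto (fun t : ℝ => t) (nhdsWithin 0 (Ioi 0)) (nhds 0) :=
      tendsto_id.mono_left nhdsWithin_le_nhds
    have := ((tendsto_mul_log_sq_nhdsGT_zero.add
      (tendsto_mul_log_nhdsGT_zero.const_mul (2 * (h - 1)))).add
      (h0.const_mul ((h - 1) ^ 2 + 2))).const_mul (N ^ 3 * O ^ 2 * B)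
    simp only [mul_zero, add_zero] at this
    exact this.congr fun t => by ring

/-- Comparison of the two energies at the matching time `T = 1 / (2 + lam)`. -/
theorem energy_at_matching_le {q' T lam w a p c g R O l : ℝ} (hq : 1 ≤ q') (hlam : 0 ≤ lam)
    (hTN : T * (2 + lam) = 1) (hw : w ≤ 1) (hp : p = R + O * (2 + lam)) (ha : a = g + O * l) :
    T * p ^ 2 + a * p + a ^ 2 / (2 * T) + T * (4 * q' + 4 * lam ^ 2 * w) * a ^ 2 + c ^ 2
      ≤ (3 + 8 * q' + 1) * (T * (R ^ 2 + (2 + lam) ^ 2 * g ^ 2 + (2 + lam) * c ^ 2))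
        + (3 + 8 * q') * ((2 + lam) * O ^ 2 * (1 + l ^ 2)) := by
  have hN' : 1 + lam ^ 2 ≤ (2 + lam) ^ 2 := by linarith
  have hN0 : 0 < 2 + lam := by linarith
  generalize 2 + lam = N at *
  have hT : T = N⁻¹ := eq_inv_of_mul_eq_one_left hTN
  have hT0 : 0 < T := hT ▸ inv_pos.2 hN0
  have hV : 4 * q' + 4 * lam ^ 2 * w ≤ 4 * q' * N ^ 2 := by
    have h1 : lam ^ 2 * w ≤ lam ^ 2 := mul_le_of_le_one_right (sq_nonneg _) hw
    have h2 : lam ^ 2 ≤ q' * lam ^ 2 := le_mul_of_one_le_left (sq_nonneg _) hq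
    have h3 := mul_le_mul_of_nonneg_left hN' (by linarith : 0 ≤ q')
    linarith
  have b1 : T * (4 * q' + 4 * lam ^ 2 * w) * a ^ 2 ≤ T * (4 * q' * N ^ 2) * a ^ 2 := by gcongr
  have b2 : a ^ 2 / (2 * T) = T * (N ^ 2 * a ^ 2 / 2) := by
    rw [hT]; field_simp
  have b3 : a * p ≤ T * ((p ^ 2 + N ^ 2 * a ^ 2) / 2) := by
    have e : a * p = T * (N * a * p) := by linear_combination (-(a * p)) * hTN
    rw [e]
    gcongr
    linarith [sq_nonneg (p - N * a)]
  have b4 : p ^ 2 ≤ 2 * (R ^ 2 + O ^ 2 * N ^ 2) := by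
    rw [hp]; linarith [sq_nonneg (R - O * N)]
  have b5 : a ^ 2 ≤ 2 * (g ^ 2 + O ^ 2 * l ^ 2) := by
    rw [ha]; linarith [sq_nonneg (g - O * l)]
  have b6 : T * (N * c ^ 2) = c ^ 2 := by linear_combination (c ^ 2) * hTN
  have b7 : N * O ^ 2 * (1 + l ^ 2) = T * (N ^ 2 * O ^ 2 * (1 + l ^ 2)) := by
    linear_combination (-(N * O ^ 2 * (1 + l ^ 2))) * hTN
  have b8 : 3 / 2 * p ^ 2 + (1 + 4 * q') * (N ^ 2 * a ^ 2) + N * c ^ 2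
      ≤ (3 + 8 * q' + 1) * (R ^ 2 + N ^ 2 * g ^ 2 + N * c ^ 2)
        + (3 + 8 * q') * (N ^ 2 * O ^ 2 * (1 + l ^ 2)) := by
    have c1 : (1 + 4 * q') * (N ^ 2 * a ^ 2)
        ≤ (1 + 4 * q') * (N ^ 2 * (2 * (g ^ 2 + O ^ 2 * l ^ 2))) := by gcongr
    have c2 : 0 ≤ (1 + 8 * q') * R ^ 2 + 8 * q' * (N ^ 2 * O ^ 2) + 2 * (N ^ 2 * g ^ 2)
        + N ^ 2 * O ^ 2 * l ^ 2 + (3 + 8 * q') * (N * c ^ 2) := by positivity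
    linarith
  have b9 := mul_le_mul_of_nonneg_left b8 hT0.le
  rw [b2, b7]
  linarith

/-- Propagation of the energy from `τ = T` to `τ = 1`. -/
theorem far_energy_le {q' F : ℝ} (hq : 1 ≤ q') (hF : 0 ≤ F) {f₁ f₂ f₃ : ℝ → ℝ}
    (h₁ : ∀ τ ≥ (0 : ℝ), |f₁ τ| ≤ F) (h₂ : ∀ τ ≥ (0 : ℝ), |f₂ τ| ≤ F)
    (h₃ : ∀ τ ≥ (0 : ℝ), |f₃ τ| ≤ F) {lam : ℝ} {a c : ℝ → ℝ}
    (hsol : SolvesModelSystem q' f₁ f₂ f₃ lam a c (Ioi 0)) {T : ℝ} (hT0 : 0 < T) (hT1 : T < 1) :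
    (1 + lam ^ 2) * a 1 ^ 2 + deriv a 1 ^ 2 ≤ 2 * (Real.exp (11 * F + 8) *
      (T * deriv a T ^ 2 + a T * deriv a T + a T ^ 2 / (2 * T)
        + T * (4 * q' + 4 * lam ^ 2 * ((T ^ 2 + 1) ^ 2)⁻¹) * a T ^ 2 + c T ^ 2)) := by
  set P : ℝ → ℝ := fun t => t * deriv a t ^ 2 + a t * deriv a t + a t ^ 2 / (2 * t)
        + t * (4 * q' + 4 * lam ^ 2 * ((t ^ 2 + 1) ^ 2)⁻¹) * a t ^ 2 + c t ^ 2 with hP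
  set W : ℝ → ℝ := fun t => -(16 * lam ^ 2 * t * ((t ^ 2 + 1) ^ 3)⁻¹) with hW
  have hd : ∀ t : ℝ, 0 < t → HasDerivAt P
      ((2 * t * deriv a t + a t) * (f₁ t * t * deriv a t + f₂ t * t ^ 2 * a t + f₃ t * c t)
        - a t ^ 2 / (2 * t ^ 2) + t * W t * a t ^ 2 + 2 * c t * (2 * t * a t)) t := by
    intro t ht
    obtain ⟨ha, ha', hc, hE, hC⟩ := hsol t ht
    have ht0 : t ≠ 0 := ht.ne'
    have hpos : t ^ 2 + 1 ≠ 0 := by positivity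
    have hid := hasDerivAt_id t
    have hV : HasDerivAt (fun t : ℝ => 4 * q' + 4 * lam ^ 2 * ((t ^ 2 + 1) ^ 2)⁻¹) (W t) t := by
      have h2 : HasDerivAt (fun t : ℝ => (t ^ 2 + 1) ^ 2) (2 * (t ^ 2 + 1) * (2 * t)) t := by
        refine ((((hasDerivAt_id t).pow 2).add_const 1).pow 2).congr_deriv ?_
        simp
      refine (((h2.inv (pow_ne_zero 2 hpos)).const_mul (4 * lam ^ 2)).const_add
        (4 * q')).congr_deriv ?_
      simp only [hW]
      field_simp
      ring
    have hq2 : HasDerivAt (fun t => a t ^ 2 / (2 * t))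
        (a t * deriv a t / t - a t ^ 2 / (2 * t ^ 2)) t := by
      refine ((ha.hasDerivAt.pow 2).div (hid.const_mul 2) (by simpa using ht0)).congr_deriv ?_
      simp only [id, Pi.pow_apply]
      push_cast
      field_simp
    refine (((((hid.mul (ha'.hasDerivAt.pow 2)).add (ha.hasDerivAt.mul ha'.hasDerivAt)).add
      hq2).add ((hid.mul hV).mul (ha.hasDerivAt.pow 2))).add
      (hc.hasDerivAt.pow 2)).congr_deriv ?_
    have ha'' : deriv (deriv a) t = -(t⁻¹ * deriv a t) - 4 * q' * a t
        - 4 * lam ^ 2 * ((t ^ 2 + 1) ^ 2)⁻¹ * a t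
        + (f₁ t * t * deriv a t + f₂ t * t ^ 2 * a t + f₃ t * c t) := by linarith
    rw [hC, ha'']
    simp only [id, Pi.pow_apply, Pi.mul_apply]
    generalize ((t ^ 2 + 1) ^ 2)⁻¹ = w
    generalize W t = w'
    push_cast
    field_simp
    ring
  have key := gronwall_of_tendsto (x := T) (T := 1) (k := 11 * F + 8) (H := P)
    (S := fun _ => 0) (s := fun _ => 0) (H0 := P T) (S0 := 0) hT1 (by positivity)
    (fun t ht => hd t (hT0.trans ht.1)) (fun t _ => hasDerivAt_const t 0) (fun _ _ => le_rfl)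
    ?_ ((hd T hT0).continuousAt.tendsto.mono_left nhdsWithin_le_nhds) tendsto_const_nhds
  · have hP1 : (1 + lam ^ 2) * a 1 ^ 2 + deriv a 1 ^ 2 ≤ 2 * P 1 := by
      simp only [hP]
      have e : 0 ≤ (q' - 1) * a 1 ^ 2 := mul_nonneg (by linarith) (sq_nonneg _)
      norm_num
      nlinarith [sq_nonneg (deriv a 1 + a 1), sq_nonneg (a 1), sq_nonneg (c 1),
        mul_nonneg (sq_nonneg lam) (sq_nonneg (a 1))]
    have hP0 : 0 ≤ P T := by
      have e : T * deriv a T ^ 2 + a T * deriv a T + a T ^ 2 / (2 * T)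
          = T * (deriv a T + a T / (2 * T)) ^ 2 + a T ^ 2 / (4 * T) := by
        field_simp
        ring
      simp only [hP]
      rw [e]
      positivity
    have hexp : Real.exp ((11 * F + 8) * (1 - T)) ≤ Real.exp (11 * F + 8) := by
      apply Real.exp_le_exp.2
      nlinarith
    have := mul_le_mul_of_nonneg_right hexp hP0
    simp only [sub_zero, add_zero] at key
    linarith
  · intro t ht
    have ht0 : 0 < t := hT0.trans ht.1
    have hV0 : 0 ≤ t * (4 * q' + 4 * lam ^ 2 * ((t ^ 2 + 1) ^ 2)⁻¹) * a t ^ 2 := by positivity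
    have hW0 : W t ≤ 0 := by
      simp only [hW]
      have : 0 ≤ 16 * lam ^ 2 * t * ((t ^ 2 + 1) ^ 3)⁻¹ := by positivity
      linarith
    have := far_energy_deriv_le (a := a t) (p := deriv a t) (c := c t) hF ht0 ht.2 hW0
      (h₁ t ht0.le) (h₂ t ht0.le) (h₃ t ht0.le) (le_add_of_nonneg_right hV0)
    simpa only [add_zero] using this

/-- Forward estimate for the singular component at `τ = 1` (single-mode version of
Corollary 3.5 of the paper). -/
theorem forward_estimate_singular (q' F : ℝ) (hq : 1 ≤ q') (hF : 0 ≤ F) :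
    ∃ C > 0, ∀ f₁ f₂ f₃ : ℝ → ℝ,
      ContinuousOn f₁ (Ici 0) → ContinuousOn f₂ (Ici 0) → ContinuousOn f₃ (Ici 0) →
      (∀ τ ≥ (0:ℝ), |f₁ τ| ≤ F) → (∀ τ ≥ (0:ℝ), |f₂ τ| ≤ F) → (∀ τ ≥ (0:ℝ), |f₃ τ| ≤ F) →
      ∀ m lam : ℝ, 1 ≤ m → 0 ≤ lam →
      ∀ a c : ℝ → ℝ, ∀ c₀ O : ℝ,
      SolvesModelSystem q' f₁ f₂ f₃ lam a c (Ioi 0) →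
      HasAsymptoticData a c c₀ O (O * Real.log m) →
      (1 + lam ^ 2) * a 1 ^ 2 + deriv a 1 ^ 2
        ≤ C * (m * O ^ 2 + lam ^ 2 * O ^ 2 / m + c₀ ^ 2) := by
  set D := 3 + 8 * q' with hD
  set B := 4 * q' + 2 * F + 4 with hB
  set k := Real.exp (2 * (4 * q' + F) + 5 * F + 5) with hk
  have hk0 : 0 < k := Real.exp_pos _
  have hB0 : 0 < B := by positivity
  have hD0 : 0 < D := by positivity
  refine ⟨2 * (Real.exp (11 * F + 8) * ((D + 1) * k * (1 + 72 * B) + 18 * D)), by positivity, ?_⟩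
  intro f₁ f₂ f₃ _ _ _ h₁ h₂ h₃ m lam hm hlam a c c₀ O hsol hdata
  have hm0 : 0 < m := by linarith
  set N := 2 + lam with hN
  have hN0 : 0 < N := by linarith
  have hN1 : 1 < N := by linarith
  set T := N⁻¹ with hT
  have hT0 : 0 < T := inv_pos.2 hN0
  have hTN : T * N = 1 := inv_mul_cancel₀ hN0.ne'
  have hT1 : T < 1 := inv_lt_one_of_one_lt₀ hN1
  have hnear := near_energy_le hq hF h₁ h₂ h₃ hlam hsol hdata hN hTN
  refine (far_energy_le hq hF h₁ h₂ h₃ hsol hT0 hT1).trans ?_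
  rw [← hk, ← hB] at hnear
  set l := Real.log T + Real.log m with hl
  set Z := N * O ^ 2 * (1 + l ^ 2) with hZ
  have hZ0 : 0 ≤ Z := by positivity
  set Q := m * O ^ 2 + lam ^ 2 * O ^ 2 / m + c₀ ^ 2 with hQ
  have hZQ : Z ≤ 18 * Q := by
    have h := log_term_le O hm hlam
    rw [← hN, ← hT, Real.log_mul hT0.ne' hm0.ne', ← hl, ← hZ] at h
    linarith [sq_nonneg c₀]
  have hcQ : c₀ ^ 2 ≤ Q := by
    have : 0 ≤ m * O ^ 2 + lam ^ 2 * O ^ 2 / m := by positivity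
    linarith
  set R := deriv a T - O / T with hR
  set g := a T - O * l with hg
  have haT : a T = g + O * l := by rw [hg]; ring
  have hOT : O / T = O * N := by rw [hT, div_inv_eq_mul]
  have hpT : deriv a T = R + O * N := by rw [hR, hOT]; ring
  set H := R ^ 2 + N ^ 2 * g ^ 2 + N * c T ^ 2 with hH
  have hTH : T * H ≤ k * (c₀ ^ 2 + 4 * B * Z) := by
    have hnear' : H ≤ k * (N * c₀ ^ 2 + N ^ 2 * O ^ 2 * B * (4 * (1 + l ^ 2))) := by
      refine hnear.trans ?_
      gcongr
      nlinarith [sq_nonneg l]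
    have := mul_le_mul_of_nonneg_left hnear' hT0.le
    have e : T * (k * (N * c₀ ^ 2 + N ^ 2 * O ^ 2 * B * (4 * (1 + l ^ 2))))
        = k * (c₀ ^ 2 + 4 * B * Z) := by
      rw [hZ]
      linear_combination (k * (c₀ ^ 2 + 4 * B * (N * O ^ 2 * (1 + l ^ 2)))) * hTN
    linarith
  have hP : T * deriv a T ^ 2 + a T * deriv a T + a T ^ 2 / (2 * T)
        + T * (4 * q' + 4 * lam ^ 2 * ((T ^ 2 + 1) ^ 2)⁻¹) * a T ^ 2 + c T ^ 2
      ≤ (D + 1) * (T * H) + D * Z := by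
    have hVle : ((T ^ 2 + 1) ^ 2)⁻¹ ≤ 1 :=
      inv_le_one_of_one_le₀ (one_le_pow₀ (by linarith [sq_nonneg T]))
    have h := energy_at_matching_le (c := c T) hq hlam hTN hVle hpT haT
    rw [← hN, ← hD, ← hH, ← hZ] at h
    exact h
  have hkB : k * (c₀ ^ 2 + 4 * B * Z) ≤ k * (1 + 72 * B) * Q := by
    have : 4 * B * Z ≤ 4 * B * (18 * Q) := by gcongr
    have := mul_le_mul_of_nonneg_left (add_le_add hcQ this) hk0.le
    linarith
  have hfin : (D + 1) * (T * H) + D * Z ≤ ((D + 1) * k * (1 + 72 * B) + 18 * D) * Q := by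
    have e1 := mul_le_mul_of_nonneg_left (hTH.trans hkB) (by positivity : 0 ≤ D + 1)
    have e2 := mul_le_mul_of_nonneg_left hZQ hD0.le
    linarith
  have := mul_le_mul_of_nonneg_left (hP.trans hfin) (Real.exp_pos (11 * F + 8)).le
  linarith
end
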